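/- arXiv:1902.08637 — 4 statements merged into one kernel-verified Lean document; each statement's English description precedes it below -/
import Mathlib

section
/- Let X be a uniformly convex complex Banach space and let T be a one-parameter holomorphic C₀-semigroup of contractions on X with generator A. Then for every ψ ∈ T₁ the operator ψ(A) is the generator of a holomorphic semigroup of contractions. -/
open MeasureTheory Filter Topology

noncomputable section

/-- A (one-parameter) `C₀`-semigroup of bounded operators on `X`. -/
def IsC0Semigroup {X : Type*} [NormedAddCommGroup X] [NormedSpace ℂ X]
    (T : ℝ → X →L[ℂ] X) : Prop :=
  T 0 = 1 ∧ (∀ s t : ℝ, 0 ≤ s → 0 ≤ t → T (s + t) = T s ∘L T t) ∧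
    ∀ x : X, Tendsto (fun t => T t x) (𝓝[≥] (0 : ℝ)) (𝓝 x)

/-- `InGenDomain T x y` means `x` belongs to the domain of the infinitesimal generator `A`
of the semigroup `T` and `A x = y`. -/
def InGenDomain {X : Type*} [NormedAddCommGroup X] [NormedSpace ℂ X]
    (T : ℝ → X →L[ℂ] X) (x y : X) : Prop :=
  Tendsto (fun t : ℝ => t⁻¹ • (T t x - x)) (𝓝[>] (0 : ℝ)) (𝓝 y)

/-- The `n`-parameter semigroup `T(u) = T₁(u₁) ⋯ Tₙ(uₙ)`. -/
def Tprod {X : Type*} [NormedAddCommGroup X] [NormedSpace ℂ X] {n : ℕ}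
    (T : Fin n → ℝ → X →L[ℂ] X) (u : Fin n → ℝ) : X →L[ℂ] X :=
  (List.ofFn fun j => T j (u j)).prod

/-- The open negative orthant `(-∞,0)ⁿ`. -/
def negOrthant (n : ℕ) : Set (Fin n → ℝ) := {s | ∀ j, s j < 0}

/-- The closed nonpositive orthant `(-∞,0]ⁿ`. -/
def nonposOrthant (n : ℕ) : Set (Fin n → ℝ) := {s | ∀ j, s j ≤ 0}

/-- A function of `n` variables is absolutely monotone on `(-∞,0)ⁿ` if it is nonnegative
together with all its iterated partial derivatives there. -/
def AbsMonotoneOn (n : ℕ) (f : (Fin n → ℝ) → ℝ) : Prop :=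
  ∀ (k : ℕ) (v : Fin k → Fin n) (s : Fin n → ℝ), s ∈ negOrthant n →
    0 ≤ iteratedFDerivWithin ℝ k f (negOrthant n) s (fun i => Pi.single (v i) 1)

/-- Membership in the class `𝒯ₙ` of (negative) Bernstein functions of `n` variables:
`ψ` is a nonpositive `C^∞`-function on `(-∞,0)ⁿ` all of whose first-order partial
derivatives are absolutely monotone. -/
def MemTn (n : ℕ) (ψ : (Fin n → ℝ) → ℝ) : Prop :=
  ContDiffOn ℝ (⊤ : ℕ∞) ψ (negOrthant n) ∧ (∀ s ∈ negOrthant n, ψ s ≤ 0) ∧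
    ∀ j : Fin n, AbsMonotoneOn n
      (fun s => fderivWithin ℝ ψ (negOrthant n) s (Pi.single j 1))

/-- The Lévy–Khintchine type representation
`ψ(s) = c₀ + c₁·s + ∫ (e^{s·u} - 1) dμ(u)` of a Bernstein function of `n` variables,
where `c₀ ≤ 0`, `c₁ ∈ ℝ₊ⁿ` and `μ` is a positive measure on `ℝ₊ⁿ \ {0}`. -/
def HasLevyRep (n : ℕ) (ψ : (Fin n → ℝ) → ℝ) (c₀ : ℝ) (c₁ : Fin n → ℝ)
    (μ : Measure (Fin n → ℝ)) : Prop :=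
  c₀ ≤ 0 ∧ (∀ j, 0 ≤ c₁ j) ∧ μ {u | ¬ ((∀ j, 0 ≤ u j) ∧ u ≠ 0)} = 0 ∧
    (∀ s ∈ negOrthant n, Integrable (fun u => Real.exp (∑ j, s j * u j) - 1) μ) ∧
    ∀ s ∈ negOrthant n, ψ s = c₀ + ∑ j, c₁ j * s j +
      ∫ u, (Real.exp (∑ j, s j * u j) - 1) ∂μ

/-- The family of bounded positive measures `ν_t` on `ℝ₊ⁿ` with
`∫ e^{s·u} dν_t(u) = e^{t ψ(s)}` (multidimensional Bernstein–Widder). -/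
def IsSubordinator (n : ℕ) (ψ : (Fin n → ℝ) → ℝ) (ν : ℝ → Measure (Fin n → ℝ)) : Prop :=
  ∀ t : ℝ, 0 ≤ t → IsFiniteMeasure (ν t) ∧ (ν t) {u | ¬ ∀ j, 0 ≤ u j} = 0 ∧
    ∀ s ∈ negOrthant n, ∫ u, Real.exp (∑ j, s j * u j) ∂(ν t) = Real.exp (t * ψ s)

/-- The holomorphic (complex) extension `ψ(λ) = c₀ + c₁·λ + ∫ (e^{λ·u} - 1) dμ(u)`
of a Bernstein function with representation `(c₀, c₁, μ)` to `{Re λ ≤ 0} ⊆ ℂⁿ`. -/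
def psiC (n : ℕ) (c₀ : ℝ) (c₁ : Fin n → ℝ) (μ : Measure (Fin n → ℝ))
    (l : Fin n → ℂ) : ℂ :=
  (c₀ : ℂ) + ∑ j, (c₁ j : ℂ) * l j +
    ∫ u, (Complex.exp (∑ j, l j * (u j : ℂ)) - 1) ∂μ

/-- The joint point spectrum of the tuple of generators of the semigroups `T j`. -/
def JointPointSpectrum {X : Type*} [NormedAddCommGroup X] [NormedSpace ℂ X] {n : ℕ}
    (T : Fin n → ℝ → X →L[ℂ] X) : Set (Fin n → ℂ) :=
  {l | ∃ x : X, x ≠ 0 ∧ ∀ j, InGenDomain (T j) x (l j • x)}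

/-- The joint approximate point spectrum of the tuple of generators of the `T j`. -/
def JointApproxSpectrum {X : Type*} [NormedAddCommGroup X] [NormedSpace ℂ X] {n : ℕ}
    (T : Fin n → ℝ → X →L[ℂ] X) : Set (Fin n → ℂ) :=
  {l | ∃ (x : ℕ → X) (y : Fin n → ℕ → X), (∀ m, ‖x m‖ = 1) ∧
    (∀ j m, InGenDomain (T j) (x m) (y j m)) ∧
    ∀ j, Tendsto (fun m => ‖y j m - l j • x m‖) atTop (𝓝 0)}

/-- The joint residual spectrum of the tuple of generators of the `T j`:
those `λ ∈ ℂⁿ` for which `Σⱼ Im (λⱼ - Aⱼ)` is not dense in `X`. -/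
def JointResidualSpectrum {X : Type*} [NormedAddCommGroup X] [NormedSpace ℂ X] {n : ℕ}
    (T : Fin n → ℝ → X →L[ℂ] X) : Set (Fin n → ℂ) :=
  {l | ¬ Dense (↑(Submodule.span ℂ
      (⋃ j, {z : X | ∃ x y, InGenDomain (T j) x y ∧ z = l j • x - y})) : Set X)}

/-- The point spectrum of a (possibly unbounded) operator given by its graph
relation `R x y ↔ (x ∈ D(B) ∧ B x = y)`. -/
def PointSpec {X : Type*} [NormedAddCommGroup X] [NormedSpace ℂ X]
    (R : X → X → Prop) : Set ℂ :=
  {α | ∃ x : X, x ≠ 0 ∧ R x (α • x)}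

/-- The approximate point spectrum of an operator given by its graph relation. -/
def ApproxSpec {X : Type*} [NormedAddCommGroup X] [NormedSpace ℂ X]
    (R : X → X → Prop) : Set ℂ :=
  {α | ∃ x y : ℕ → X, (∀ m, ‖x m‖ = 1) ∧ (∀ m, R (x m) (y m)) ∧
    Tendsto (fun m => ‖y m - α • x m‖) atTop (𝓝 0)}

/-- The residual spectrum of an operator given by its graph relation:
those `α` for which `Im (α - B)` is not dense. -/
def ResidualSpec {X : Type*} [NormedAddCommGroup X] [NormedSpace ℂ X]
    (R : X → X → Prop) : Set ℂ :=
  {α | ¬ Dense (↑(Submodule.span ℂ {z : X | ∃ x y, R x y ∧ z = α • x - y}) : Set X)}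

/-- The resolvent set of a closed operator given by its graph relation: `α` such that
`α - B : D(B) → X` has a bounded everywhere-defined inverse. -/
def ResolventSet {X : Type*} [NormedAddCommGroup X] [NormedSpace ℂ X]
    (R : X → X → Prop) : Set ℂ :=
  {α | ∃ Rv : X →L[ℂ] X, (∀ z : X, R (Rv z) (α • Rv z - z)) ∧
    ∀ x y : X, R x y → Rv (α • x - y) = x}

/-- The constant `K_M = (M+1)/(1 - e^{-(M+1)/M})` from the moment inequality. -/
def KM (M : ℝ) : ℝ := (M + 1) / (1 - Real.exp (-(M + 1) / M))

/-- The open sector `{z ≠ 0 : |arg z| < θ}` in `ℂ`. -/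
def Sector (θ : ℝ) : Set ℂ := {z | z ≠ 0 ∧ |Complex.arg z| < θ}

/-- A `C₀`-semigroup is holomorphic if it extends to a holomorphic semigroup on some
open sector around the positive half axis, strongly continuous at `0` in the sector. -/
def IsHolomorphicSemigroup {X : Type*} [NormedAddCommGroup X] [NormedSpace ℂ X]
    (T : ℝ → X →L[ℂ] X) : Prop :=
  ∃ (θ : ℝ) (S : ℂ → X →L[ℂ] X), 0 < θ ∧ (∀ t : ℝ, 0 < t → S t = T t) ∧
    (∀ z w : ℂ, z ∈ Sector θ → w ∈ Sector θ → S (z + w) = S z ∘L S w) ∧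
    DifferentiableOn ℂ S (Sector θ) ∧
    ∀ x : X, Tendsto (fun z => S z x) (𝓝[Sector θ] 0) (𝓝 x)

end

noncomputable section
section Helpers
variable {X : Type*} [NormedAddCommGroup X] [NormedSpace ℂ X]

theorem aux_cont (T : ℝ → X →L[ℂ] X) (hT : IsC0Semigroup T)
    (hc : ∀ t, 0 ≤ t → ‖T t‖ ≤ 1) (x : X) : Continuous (fun s : ℝ => T (max s 0) x) := by
  obtain ⟨h0, hadd, hlim⟩ := hT
  have key : ∀ s t : ℝ, 0 ≤ s → s ≤ t → ‖T t x - T s x‖ ≤ ‖T (t - s) x - x‖ := by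
    intro s t hs hst
    have h1 : T t = T s ∘L T (t - s) := by
      rw [← hadd s (t - s) hs (by linarith)]; congr 1; ring
    have h2 : T t x - T s x = T s (T (t - s) x - x) := by
      rw [h1, map_sub]; rfl
    rw [h2]
    calc ‖T s (T (t - s) x - x)‖ ≤ ‖T s‖ * ‖T (t - s) x - x‖ := (T s).le_opNorm _
      _ ≤ 1 * ‖T (t - s) x - x‖ := by gcongr; exact hc s hs
      _ = _ := one_mul _
  have key2 : ∀ s t : ℝ, ‖T (max t 0) x - T (max s 0) x‖ ≤ ‖T (|max t 0 - max s 0|) x - x‖ := by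
    intro s t
    rcases le_total (max s 0) (max t 0) with h | h
    · rw [abs_of_nonneg (by linarith)]
      exact key _ _ (le_max_right _ _) h
    · rw [abs_sub_comm, abs_of_nonneg (by linarith), norm_sub_rev]
      exact key _ _ (le_max_right _ _) h
  rw [continuous_iff_continuousAt]
  intro s
  rw [ContinuousAt, tendsto_iff_norm_sub_tendsto_zero]
  have h3 : Tendsto (fun t : ℝ => |max t 0 - max s 0|) (𝓝 s) (𝓝[≥] 0) := by
    refine tendsto_nhdsWithin_iff.2 ⟨?_, Eventually.of_forall fun t => Set.mem_Ici.2 (abs_nonneg _)⟩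
    have : Continuous (fun t : ℝ => |max t 0 - max s 0|) := by fun_prop
    have := this.tendsto s
    simpa using this
  have h4 := (tendsto_iff_norm_sub_tendsto_zero.1 ((hlim x).comp h3))
  exact squeeze_zero (fun _ => norm_nonneg _) (fun t => key2 s t) h4

/-- holomorphic contraction semigroup: `1 + T t` uniformly bounded below for small `t`. -/
theorem aux_lower [CompleteSpace X] (T : ℝ → X →L[ℂ] X) (hT : IsC0Semigroup T)
    (hc : ∀ t, 0 ≤ t → ‖T t‖ ≤ 1) (hh : IsHolomorphicSemigroup T) :
    ∃ ε > 0, ∃ δ > 0, ∀ t : ℝ, 0 < t → t < δ → ∀ x : X, ε * ‖x‖ ≤ ‖x + T t x‖ := by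
  obtain ⟨h0, hadd, -⟩ := hT
  obtain ⟨θ, S, hθ, hST, -, hdiff, hlim⟩ := hh
  -- local boundedness
  obtain ⟨r, hr, M, hM⟩ : ∃ r > 0, ∃ M : ℝ, ∀ z ∈ Sector θ, ‖z‖ < r → ‖S z‖ ≤ M := by
    by_contra! hcon
    choose z hz1 hz2 hz3 using fun n : ℕ => hcon (1 / ((n : ℝ) + 1)) (by positivity) n
    have hz0 : Tendsto z atTop (𝓝[Sector θ] 0) := by
      refine tendsto_nhdsWithin_iff.2 ⟨?_, Eventually.of_forall hz1⟩
      rw [tendsto_zero_iff_norm_tendsto_zero]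
      exact squeeze_zero (fun _ => norm_nonneg _) (fun n => (hz2 n).le)
        tendsto_one_div_add_atTop_nhds_zero_nat
    obtain ⟨C, hC⟩ := banach_steinhaus (g := fun n => S (z n)) (by
      intro x
      have h1 := ((hlim x).comp hz0).norm.bddAbove_range
      obtain ⟨C, hC⟩ := h1
      exact ⟨C, fun n => hC ⟨n, rfl⟩⟩)
    obtain ⟨n, hn⟩ := exists_nat_gt C
    linarith [hC n, hz3 n]
  -- ball around 1 in sector
  obtain ⟨c, hc0, hcs⟩ : ∃ c > 0, Metric.ball (1 : ℂ) c ⊆ Sector θ := by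
    have h1 : ∀ᶠ z : ℂ in 𝓝 1, z ≠ 0 ∧ |Complex.arg z| < θ := by
      refine (eventually_ne_nhds one_ne_zero).and ?_
      have : ContinuousAt (fun z : ℂ => |Complex.arg z|) 1 :=
        (Complex.continuousAt_arg (by simp)).abs
      have h2 := this.tendsto
      simp only [Complex.arg_one, abs_zero] at h2
      exact h2.eventually (gt_mem_nhds hθ)
    exact Metric.mem_nhds_iff.1 h1
  have hball : ∀ s : ℝ, 0 < s → Metric.ball (s : ℂ) (c * s) ⊆ Sector θ := by
    intro s hs z hz
    have h1 : (s : ℂ)⁻¹ * z ∈ Sector θ := by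
      apply hcs
      rw [Metric.mem_ball, dist_eq_norm] at hz ⊢
      have hs' : (s : ℂ) ≠ 0 := by exact_mod_cast hs.ne'
      have : (s : ℂ)⁻¹ * z - 1 = (s : ℂ)⁻¹ * (z - s) := by field_simp
      rw [this, norm_mul, norm_inv, Complex.norm_real, Real.norm_of_nonneg hs.le]
      rw [inv_mul_lt_iff₀ hs]; linarith
    obtain ⟨h2, h3⟩ := h1
    refine ⟨fun h => h2 (by simp [h]), ?_⟩
    rw [← Complex.ofReal_inv, Complex.arg_real_mul _ (inv_pos.2 hs)] at h3
    exact h3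
  have hM0 : 0 ≤ M := by
    have hz : ((r / 2 : ℝ) : ℂ) ∈ Sector θ := by
      apply hball (r / 2) (by linarith)
      exact Metric.mem_ball_self (by positivity)
    refine (norm_nonneg _).trans (hM _ hz ?_)
    rw [Complex.norm_real, Real.norm_of_nonneg (by linarith)]; linarith
  set C : ℝ := 2 * M / c with hC
  have hC0 : 0 ≤ C := by positivity
  -- difference estimate
  have hdiffest : ∀ s t : ℝ, 0 < s → 0 < t → t < c * s → s * (1 + c) < r →
      ‖T (s + t) - T s‖ ≤ C / s * t := by
    intro s t hs ht htc hsr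
    have hmem : ∀ z ∈ Metric.ball (s : ℂ) (c * s), ‖S z‖ ≤ M := by
      intro z hz
      refine hM z (hball s hs hz) ?_
      rw [Metric.mem_ball, dist_eq_norm] at hz
      have : ‖z‖ ≤ ‖z - s‖ + ‖(s : ℂ)‖ := by simpa using norm_add_le (z - s) (s : ℂ)
      rw [Complex.norm_real, Real.norm_of_nonneg hs.le] at this
      nlinarith
    have h1 := Complex.dist_le_div_mul_dist_of_mapsTo_ball (f := S) (c := (s : ℂ))
      (z := ((s + t : ℝ) : ℂ)) (R₁ := c * s) (R₂ := 2 * M)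
      (hdiff.mono (hball s hs)) (by
        intro z hz
        rw [Metric.mem_closedBall, dist_eq_norm]
        have := hmem z hz
        have h2 := hmem s (Metric.mem_ball_self (by positivity))
        linarith [norm_sub_le (S z) (S s)]) (by
        rw [Metric.mem_ball, dist_eq_norm]
        simpa [abs_of_pos ht] using htc)
    rw [hST _ hs, hST _ (by linarith), dist_eq_norm, dist_eq_norm] at h1
    have h3 : ‖((s + t : ℝ) : ℂ) - s‖ = t := by simp [abs_of_pos ht]
    rw [h3] at h1
    refine h1.trans (le_of_eq ?_)
    rw [hC]; field_simp
  obtain ⟨m, hm⟩ := exists_nat_gt (max C (1 / c))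
  have hm1 : C < m := (le_max_left _ _).trans_lt hm
  have hm2 : 1 / c < m := (le_max_right _ _).trans_lt hm
  have hm0 : (0 : ℝ) < m := hC0.trans_lt hm1
  refine ⟨1 / (2 * m + 1), by positivity, r / (m * (1 + c)), by positivity, ?_⟩
  intro t ht htr x
  set y := x + T t x with hy
  have hcx : ∀ s : ℝ, 0 ≤ s → ∀ z : X, ‖T s z‖ ≤ ‖z‖ := by
    intro s hs z
    calc ‖T s z‖ ≤ ‖T s‖ * ‖z‖ := (T s).le_opNorm _
      _ ≤ 1 * ‖z‖ := by gcongr; exact hc s hs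
      _ = _ := one_mul _
  have hlow : ∀ j : ℕ, ‖x‖ - j * ‖y‖ ≤ ‖T (j * t) x‖ := by
    intro j
    induction j with
    | zero => simp [h0]
    | succ j ih =>
      have hj : 0 ≤ (j : ℝ) * t := by positivity
      have e1 : T (((j + 1 : ℕ) : ℝ) * t) x = T (j * t) (T t x) := by
        have : ((j + 1 : ℕ) : ℝ) * t = j * t + t := by push_cast; ring
        rw [this, hadd _ _ hj ht.le]; rfl
      have e2 : T (j * t) x = T (j * t) y - T (j * t) (T t x) := by
        rw [hy, map_add]; abel
      have e3 : ‖T (j * t) x‖ ≤ ‖y‖ + ‖T (j * t) (T t x)‖ := by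
        rw [e2]
        exact (norm_sub_le _ _).trans (by gcongr; exact hcx _ hj _)
      rw [e1]; push_cast; linarith
  have hmt : 0 < m * t := by positivity
  have e4 := hdiffest (m * t) t hmt ht (by
      rw [div_lt_iff₀ hc0] at hm2; nlinarith) (by
      rw [lt_div_iff₀ (by positivity)] at htr; nlinarith)
  have e5 : C / (m * t) * t ≤ 1 := by
    rw [div_mul_eq_mul_div, div_le_one hmt]; nlinarith
  have e6 : ‖T (m * t + t) x - T (m * t) x‖ ≤ ‖x‖ := by
    calc ‖T (m * t + t) x - T (m * t) x‖ = ‖(T (m * t + t) - T (m * t)) x‖ := rfl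
      _ ≤ ‖T (m * t + t) - T (m * t)‖ * ‖x‖ := ContinuousLinearMap.le_opNorm _ _
      _ ≤ 1 * ‖x‖ := by gcongr; linarith
      _ = _ := one_mul _
  have e7 : (2 : ℝ) • T (m * t) x = T (m * t) y - (T (m * t + t) x - T (m * t) x) := by
    rw [hadd _ _ hmt.le ht.le, hy, map_add, two_smul, ContinuousLinearMap.comp_apply]
    abel
  have e8 : 2 * ‖T (m * t) x‖ ≤ ‖y‖ + ‖x‖ := by
    calc 2 * ‖T (m * t) x‖ = ‖(2 : ℝ) • T (m * t) x‖ := by rw [norm_smul]; simp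
      _ ≤ _ := by
        rw [e7]; refine (norm_sub_le _ _).trans ?_
        gcongr
        exact hcx _ hmt.le _
  have e9 := hlow m
  rw [div_mul_eq_mul_div, div_le_iff₀ (by positivity)]
  nlinarith

theorem aux_upper [CompleteSpace X] [UniformConvexSpace X] (T : ℝ → X →L[ℂ] X)
    (hT : IsC0Semigroup T)
    (hc : ∀ t, 0 ≤ t → ‖T t‖ ≤ 1) (hh : IsHolomorphicSemigroup T) :
    ∃ ε > 0, ∃ δ > 0, ∀ t : ℝ, 0 < t → t < δ → ∀ x : X, ‖x - T t x‖ ≤ (2 - ε) * ‖x‖ := by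
  obtain ⟨ε, hε, δ, hδ, h⟩ := aux_lower T hT hc hh
  obtain ⟨η, hη, h2⟩ := exists_forall_closed_ball_dist_add_le_two_sub X hε
  refine ⟨η, hη, δ, hδ, fun t ht htδ x => ?_⟩
  rcases eq_or_ne x 0 with rfl | hx
  · simp
  have hx' : 0 < ‖x‖ := norm_pos_iff.2 hx
  set e : X := ((‖x‖⁻¹ : ℝ) : ℂ) • x with he
  have hen : ‖e‖ = 1 := by
    rw [he, norm_smul, Complex.norm_real, norm_inv, norm_norm, inv_mul_cancel₀ hx'.ne']
  have hTe : ‖-T t e‖ ≤ 1 := by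
    rw [norm_neg]
    calc ‖T t e‖ ≤ ‖T t‖ * ‖e‖ := (T t).le_opNorm _
      _ ≤ 1 := by rw [hen, mul_one]; exact hc t ht.le
  have h3 := h2 hen.le hTe (by
    have := h t ht htδ e
    rw [hen] at this; simpa using this)
  have hxe : x = ((‖x‖ : ℝ) : ℂ) • e := by
    rw [he, smul_smul, ← Complex.ofReal_mul, mul_inv_cancel₀ hx'.ne']; simp
  have h4 : x - T t x = ((‖x‖ : ℝ) : ℂ) • (e + -T t e) := by
    conv_lhs => rw [hxe]
    rw [map_smul, smul_add, smul_neg, sub_eq_add_neg]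
  rw [h4, norm_smul, Complex.norm_real, norm_norm, mul_comm]
  gcongr

/-- Facts about the subordinated semigroup. -/
theorem aux_sub [CompleteSpace X] [UniformConvexSpace X] (T : ℝ → X →L[ℂ] X)
    (hT : IsC0Semigroup T)
    (hc : ∀ t, 0 ≤ t → ‖T t‖ ≤ 1) (hh : IsHolomorphicSemigroup T)
    (ψ : (Fin 1 → ℝ) → ℝ) (hψ : MemTn 1 ψ)
    (ν : ℝ → MeasureTheory.Measure (Fin 1 → ℝ)) (hν : IsSubordinator 1 ψ ν)
    (g : ℝ → X →L[ℂ] X)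
    (hg : ∀ t, 0 ≤ t → ∀ x : X, g t x = ∫ u, T (u 0) x ∂(ν t)) :
    (∀ t, 0 ≤ t → ‖g t‖ ≤ 1) ∧
    ∃ ε > 0, ∃ δ > 0, ∀ t : ℝ, 0 < t → t < δ → ∀ x : X, ‖x - g t x‖ ≤ (2 - ε) * ‖x‖ := by
  have hcx : ∀ s : ℝ, 0 ≤ s → ∀ z : X, ‖T s z‖ ≤ ‖z‖ := by
    intro s hs z
    calc ‖T s z‖ ≤ ‖T s‖ * ‖z‖ := (T s).le_opNorm _
      _ ≤ 1 * ‖z‖ := by gcongr; exact hc s hs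
      _ = _ := one_mul _
  have hae : ∀ t, 0 ≤ t → ∀ᵐ u ∂(ν t), 0 ≤ u 0 := by
    intro t ht
    have := (hν t ht).2.1
    rw [ae_iff]
    refine measure_mono_null ?_ this
    intro u hu h
    exact hu (h 0)
  have hint : ∀ t, 0 ≤ t → ∀ x, Integrable (fun u : Fin 1 → ℝ => T (u 0) x) (ν t) := by
    intro t ht x
    have := (hν t ht).1
    have h1 : Integrable (fun u : Fin 1 → ℝ => T (max (u 0) 0) x) (ν t) := by
      refine Integrable.of_bound (C := ‖x‖) ?_ (Eventually.of_forall fun u => hcx _ (le_max_right _ _) x)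
      exact ((aux_cont T hT hc x).comp (continuous_apply 0)).aestronglyMeasurable
    refine h1.congr ?_
    filter_upwards [hae t ht] with u hu
    rw [max_eq_left hu]
  have hexpint : ∀ t, 0 ≤ t → ∀ s : ℝ, 0 ≤ s →
      Integrable (fun u : Fin 1 → ℝ => Real.exp (-(s * u 0))) (ν t) := by
    intro t ht s hs
    have := (hν t ht).1
    refine Integrable.of_bound (C := 1) ?_ ?_
    · exact (by fun_prop : Continuous (fun u : Fin 1 → ℝ => Real.exp (-(s * u 0)))).aestronglyMeasurable
    · filter_upwards [hae t ht] with u hu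
      rw [Real.norm_eq_abs, Real.abs_exp, Real.exp_le_one_iff]
      have : 0 ≤ s * u 0 := by positivity
      linarith
  have hlap : ∀ t, 0 ≤ t → ∀ s : ℝ, 0 < s →
      ∫ u : Fin 1 → ℝ, Real.exp (-(s * u 0)) ∂(ν t) = Real.exp (t * ψ (fun _ => -s)) := by
    intro t ht s hs
    have := (hν t ht).2.2 (fun _ => -s) (fun _ => by simpa using hs)
    simpa using this
  have hψ0 : ∀ s : ℝ, 0 < s → ψ (fun _ => -s) ≤ 0 := fun s hs =>
    hψ.2.1 _ (fun _ => by simpa using hs)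
  have hmass : ∀ t, 0 ≤ t → (ν t).real Set.univ ≤ 1 := by
    intro t ht
    have := (hν t ht).1
    have h1 : Tendsto (fun n : ℕ => ∫ u : Fin 1 → ℝ, Real.exp (-((1 / ((n : ℝ) + 1)) * u 0)) ∂(ν t))
        atTop (𝓝 (∫ u : Fin 1 → ℝ, (1 : ℝ) ∂(ν t))) := by
      refine tendsto_integral_of_dominated_convergence (fun _ => (1 : ℝ)) ?_ (integrable_const _) ?_ ?_
      · intro n
        exact (hexpint t ht _ (by positivity)).aestronglyMeasurable
      · intro n
        filter_upwards [hae t ht] with u hu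
        rw [Real.norm_eq_abs, Real.abs_exp, Real.exp_le_one_iff]
        have : 0 ≤ (1 / ((n : ℝ) + 1)) * u 0 := by positivity
        linarith
      · refine Eventually.of_forall fun u => ?_
        have h2 : Tendsto (fun n : ℕ => Real.exp (-((1 / ((n : ℝ) + 1)) * u 0))) atTop
            (𝓝 (Real.exp (-(0 * u 0)))) :=
          (Real.continuous_exp.tendsto _).comp
            ((tendsto_one_div_add_atTop_nhds_zero_nat.mul_const (u 0)).neg)
        simpa using h2
    have h3 : ∫ u : Fin 1 → ℝ, (1 : ℝ) ∂(ν t) ≤ 1 := by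
      refine le_of_tendsto h1 (Eventually.of_forall fun n => ?_)
      rw [hlap t ht _ (by positivity), Real.exp_le_one_iff]
      exact mul_nonpos_of_nonneg_of_nonpos ht (hψ0 _ (by positivity))
    simpa using h3
  refine ⟨fun t ht => ?_, ?_⟩
  · have := (hν t ht).1
    refine ContinuousLinearMap.opNorm_le_bound _ zero_le_one fun x => ?_
    rw [hg t ht x, one_mul]
    calc ‖∫ u, T (u 0) x ∂(ν t)‖ ≤ ‖x‖ * (ν t).real Set.univ := by
          refine norm_integral_le_of_norm_le_const ?_
          filter_upwards [hae t ht] with u hu using hcx _ hu x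
      _ ≤ ‖x‖ * 1 := by gcongr; exact hmass t ht
      _ = _ := mul_one _
  obtain ⟨ε, hε, δ, hδ, hup⟩ := aux_upper T hT hc hh
  set K : ℝ := 2 / (1 - Real.exp (-δ)) with hK
  have hed : Real.exp (-δ) < 1 := by rw [Real.exp_lt_one_iff]; linarith
  have hK0 : 0 < K := by rw [hK]; exact div_pos two_pos (by linarith)
  set p : ℝ := ψ (fun _ => -1) with hp
  have hlim : Tendsto (fun t : ℝ => (K + 1) * (1 - Real.exp (t * p))) (𝓝 0) (𝓝 0) := by
    have : Continuous (fun t : ℝ => (K + 1) * (1 - Real.exp (t * p))) := by fun_prop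
    simpa using this.tendsto 0
  set ε' := min ε 2 with hε'
  have hε'0 : 0 < ε' := lt_min hε two_pos
  obtain ⟨d, hd, hd2⟩ := Metric.eventually_nhds_iff.1 (hlim.eventually (gt_mem_nhds (half_pos hε'0)))
  refine ⟨ε' / 2, half_pos hε'0, d, hd, fun t ht htd x => ?_⟩
  have := (hν t ht.le).1
  have hsmall := hd2 (y := t) (by simpa [abs_of_pos ht] using htd)
  have hpt : ∀ᵐ u ∂(ν t), ‖x - T (u 0) x‖ ≤ ((2 - ε') + K * (1 - Real.exp (-(1 * u 0)))) * ‖x‖ := by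
    filter_upwards [hae t ht.le] with u hu
    have hexp : 0 ≤ 1 - Real.exp (-(1 * u 0)) := by
      have : Real.exp (-(1 * u 0)) ≤ 1 := by rw [Real.exp_le_one_iff]; linarith
      linarith
    have hε2 : ε' ≤ 2 := min_le_right _ _
    rcases hu.eq_or_lt with h0 | h0
    · rw [← h0, hT.1]; simp
      exact mul_nonneg (by linarith) (norm_nonneg _)
    rcases lt_or_ge (u 0) δ with h | h
    · refine (hup _ h0 h x).trans ?_
      gcongr
      have : ε' ≤ ε := min_le_left _ _
      nlinarith [mul_nonneg hK0.le hexp]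
    · have h1 : ‖x - T (u 0) x‖ ≤ 2 * ‖x‖ := by
        linarith [norm_sub_le x (T (u 0) x), hcx _ hu x]
      refine h1.trans ?_
      gcongr
      have h2 : Real.exp (-(1 * u 0)) ≤ Real.exp (-δ) := by
        rw [Real.exp_le_exp]; linarith
      have h3 : 2 ≤ K * (1 - Real.exp (-(1 * u 0))) := by
        rw [hK, div_mul_eq_mul_div, le_div_iff₀ (by linarith)]; linarith
      linarith
  have hm1 := hmass t ht.le
  have hl := hlap t ht.le 1 one_pos
  set m := (ν t).real Set.univ with hm
  have hm0 : 0 ≤ m := measureReal_nonneg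
  have hmlow : Real.exp (t * p) ≤ m := by
    rw [hp, ← hl]
    have : ∫ u : Fin 1 → ℝ, Real.exp (-(1 * u 0)) ∂(ν t) ≤ ∫ u : Fin 1 → ℝ, (1 : ℝ) ∂(ν t) := by
      refine integral_mono_ae (hexpint t ht.le 1 zero_le_one) (integrable_const _) ?_
      filter_upwards [hae t ht.le] with u hu
      rw [Real.exp_le_one_iff]; linarith
    simpa using this
  have e1 : x - g t x = (1 - m) • x + ∫ u, (x - T (u 0) x) ∂(ν t) := by
    rw [integral_sub (integrable_const _) (hint t ht.le x), hg t ht.le x, integral_const, sub_smul,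
      one_smul, ← hm]
    abel
  have e2 : ‖∫ u, (x - T (u 0) x) ∂(ν t)‖ ≤ ((2 - ε') * m + K * (m - Real.exp (t * p))) * ‖x‖ := by
    have hi : Integrable (fun u : Fin 1 → ℝ => ((2 - ε') + K * (1 - Real.exp (-(1 * u 0)))) * ‖x‖) (ν t) :=
      ((integrable_const _).add (((integrable_const _).sub
        (hexpint t ht.le 1 zero_le_one)).const_mul _)).mul_const _
    refine (norm_integral_le_of_norm_le hi hpt).trans (le_of_eq ?_)
    have hi2 : Integrable (fun u : Fin 1 → ℝ => K * (1 - Real.exp (-(1 * u 0)))) (ν t) :=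
      ((integrable_const _).sub (hexpint t ht.le 1 zero_le_one)).const_mul _
    rw [integral_mul_const, integral_add (integrable_const _) hi2, integral_const_mul, integral_sub (integrable_const _) (hexpint t ht.le 1 zero_le_one), hl]
    simp only [integral_const, smul_eq_mul, ← hm, ← hp]
    ring
  rw [e1]
  refine (norm_add_le _ _).trans ?_
  rw [norm_smul, Real.norm_of_nonneg (by linarith)]
  have e3 : (1 - m) + ((2 - ε') * m + K * (m - Real.exp (t * p))) ≤ 2 - ε' / 2 := by
    have : ε' ≤ 2 := min_le_right _ _
    nlinarith
  calc (1 - m) * ‖x‖ + _ ≤ (1 - m) * ‖x‖ + ((2 - ε') * m + K * (m - Real.exp (t * p))) * ‖x‖ := by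
        gcongr
    _ = ((1 - m) + ((2 - ε') * m + K * (m - Real.exp (t * p)))) * ‖x‖ := by ring
    _ ≤ _ := by gcongr

end Helpers

section Helpers2
variable {X : Type*} [NormedAddCommGroup X] [NormedSpace ℂ X]

/-- The integrand of the Laplace transform. -/
def auxE (S : ℝ → X →L[ℂ] X) (l : ℂ) (x : X) (s : ℝ) : X :=
  Complex.exp (-(l * s)) • S (max s 0) x

theorem auxE_cont (S : ℝ → X →L[ℂ] X) (hS : IsC0Semigroup S)
    (hc : ∀ t, 0 ≤ t → ‖S t‖ ≤ 1) (l : ℂ) (x : X) : Continuous (auxE S l x) := by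
  unfold auxE
  exact (by fun_prop : Continuous fun s : ℝ => Complex.exp (-(l * s))).smul (aux_cont S hS hc x)

theorem auxE_norm (S : ℝ → X →L[ℂ] X)
    (hc : ∀ t, 0 ≤ t → ‖S t‖ ≤ 1) (l : ℂ) (x : X) (s : ℝ) :
    ‖auxE S l x s‖ ≤ Real.exp (-(l.re * s)) * ‖x‖ := by
  unfold auxE
  rw [norm_smul, Complex.norm_exp]
  have : (-(l * s)).re = -(l.re * s) := by simp
  rw [this]
  gcongr
  calc ‖S (max s 0) x‖ ≤ ‖S (max s 0)‖ * ‖x‖ := (S _).le_opNorm _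
    _ ≤ 1 * ‖x‖ := by gcongr; exact hc _ (le_max_right _ _)
    _ = _ := one_mul _

theorem aux_realint (a : ℝ) (ha : 0 < a) (k : ℕ) :
    IntegrableOn (fun s : ℝ => s ^ k * Real.exp (-(a * s))) (Set.Ioi 0) := by
  have h := integrableOn_rpow_mul_exp_neg_mul_rpow (p := 1) (s := k) (b := a)
    (by have : (0:ℝ) ≤ k := by positivity
        linarith) one_pos ha
  refine h.congr_fun (fun s hs => ?_) measurableSet_Ioi
  simp

theorem auxE_int (S : ℝ → X →L[ℂ] X) (hS : IsC0Semigroup S)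
    (hc : ∀ t, 0 ≤ t → ‖S t‖ ≤ 1) (l : ℂ) (hl : 0 < l.re) (x : X) (k : ℕ) :
    IntegrableOn (fun s : ℝ => (s ^ k : ℝ) • auxE S l x s) (Set.Ioi 0) := by
  have hcont := auxE_cont S hS hc l x
  refine Integrable.mono' ((aux_realint l.re hl k).mul_const ‖x‖)
    (by fun_prop : Continuous (fun s : ℝ => (s ^ k : ℝ) • auxE S l x s)).aestronglyMeasurable ?_
  filter_upwards [ae_restrict_mem measurableSet_Ioi] with s hs
  have hs' : (0 : ℝ) < s := hs
  rw [norm_smul, Real.norm_of_nonneg (by positivity), mul_assoc]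
  gcongr
  exact auxE_norm S hc l x s

theorem aux_J2_triv (S : ℝ → X →L[ℂ] X)
    (hc : ∀ t, 0 ≤ t → ‖S t‖ ≤ 1) (l : ℂ) (hl : 0 < l.re) (x : X) :
    ‖∫ s in Set.Ioi (0 : ℝ), (s ^ 2 : ℝ) • auxE S l x s‖ ≤ 2 / l.re ^ 3 * ‖x‖ := by
  have h1 : ∫ s in Set.Ioi (0 : ℝ), s ^ 2 * Real.exp (-(l.re * s)) = 2 / l.re ^ 3 := by
    have h := Real.integral_rpow_mul_exp_neg_mul_Ioi (a := 3) (r := l.re) (by norm_num) hl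
    have hG : Real.Gamma 3 = 2 := by
      have := Real.Gamma_nat_eq_factorial 2
      rw [show ((2 : ℕ) : ℝ) + 1 = 3 by norm_num] at this
      rw [this]; norm_num [Nat.factorial]
    rw [hG] at h
    have e : (1 / l.re) ^ (3 : ℝ) = 1 / l.re ^ 3 := by
      rw [show (3 : ℝ) = ((3 : ℕ) : ℝ) by norm_num, Real.rpow_natCast]; simp
    rw [e] at h
    rw [show 2 / l.re ^ 3 = 1 / l.re ^ 3 * 2 by ring, ← h]
    refine setIntegral_congr_fun measurableSet_Ioi (fun s hs => ?_)
    have : (3 : ℝ) - 1 = ((2 : ℕ) : ℝ) := by norm_num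
    simp only [this, Real.rpow_natCast]
  rw [← h1, ← integral_mul_const]
  refine norm_integral_le_of_norm_le ((aux_realint l.re hl 2).mul_const ‖x‖) ?_
  filter_upwards [ae_restrict_mem measurableSet_Ioi] with s hs
  have hs' : (0 : ℝ) < s := hs
  rw [norm_smul, Real.norm_of_nonneg (by positivity), mul_assoc]
  gcongr
  exact auxE_norm S hc l x s

theorem aux_shift [CompleteSpace X] (S : ℝ → X →L[ℂ] X) (hS : IsC0Semigroup S)
    (hc : ∀ t, 0 ≤ t → ‖S t‖ ≤ 1) (l : ℂ) (hl : 0 < l.re) (x : X) (k : ℕ) (t : ℝ) (ht : 0 < t)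
    (hi : IntegrableOn (fun s : ℝ => ((s - t) ^ k : ℝ) • auxE S l x s) (Set.Ioi 0)) :
    Complex.exp (-(l * t)) • S t (∫ s in Set.Ioi (0 : ℝ), (s ^ k : ℝ) • auxE S l x s) =
      (∫ s in Set.Ioi (0 : ℝ), ((s - t) ^ k : ℝ) • auxE S l x s) -
      ∫ s in Set.Ioc (0 : ℝ) t, ((s - t) ^ k : ℝ) • auxE S l x s := by
  have h1 : Complex.exp (-(l * t)) • S t (∫ s in Set.Ioi (0 : ℝ), (s ^ k : ℝ) • auxE S l x s)
      = ∫ s in Set.Ioi (0 : ℝ), (((s + t) - t) ^ k : ℝ) • auxE S l x (s + t) := by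
    rw [← ContinuousLinearMap.integral_comp_comm _ (auxE_int S hS hc l hl x k), ← integral_smul]
    refine setIntegral_congr_fun measurableSet_Ioi (fun s hs => ?_)
    have hs' : (0 : ℝ) < s := hs
    simp only [auxE, add_sub_cancel_right]
    rw [max_eq_left hs'.le, max_eq_left (by linarith), add_comm s t, hS.2.1 t s ht.le hs'.le,
      ContinuousLinearMap.comp_apply]
    have : Complex.exp (-(l * ((t + s : ℝ) : ℂ))) = Complex.exp (-(l * t)) * Complex.exp (-(l * s)) := by
      rw [← Complex.exp_add]; push_cast; ring_nf
    rw [this, mul_smul]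
    rw [← Complex.coe_smul, ← Complex.coe_smul, map_smul, map_smul, smul_comm]
  rw [h1]
  have h2 := (measurePreserving_add_right volume t).setIntegral_preimage_emb
    (measurableEmbedding_addRight t) (fun s : ℝ => ((s - t) ^ k : ℝ) • auxE S l x s) (Set.Ioi t)
  have h3 : (fun s : ℝ => s + t) ⁻¹' Set.Ioi t = Set.Ioi 0 := by ext; simp
  rw [h3] at h2
  rw [h2, eq_sub_iff_add_eq, add_comm, ← setIntegral_union]
  · rw [Set.Ioc_union_Ioi_eq_Ioi ht.le]
  · exact Set.Ioc_disjoint_Ioi le_rfl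
  · exact measurableSet_Ioi
  · exact hi.mono_set Set.Ioc_subset_Ioi_self
  · exact hi.mono_set (Set.Ioi_subset_Ioi ht.le)

theorem aux_Ebound (S : ℝ → X →L[ℂ] X)
    (hc : ∀ t, 0 ≤ t → ‖S t‖ ≤ 1) (l : ℂ) (hl : 0 < l.re) (x : X) (k : ℕ) (t : ℝ) (ht : 0 < t) :
    ‖∫ s in Set.Ioc (0 : ℝ) t, ((s - t) ^ k : ℝ) • auxE S l x s‖ ≤ t ^ (k + 1) * ‖x‖ := by
  have h := norm_setIntegral_le_of_norm_le_const (μ := volume) (s := Set.Ioc (0 : ℝ) t)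
    (f := fun s : ℝ => ((s - t) ^ k : ℝ) • auxE S l x s) (C := t ^ k * ‖x‖) (by simp) (by
      intro s hs
      rw [norm_smul, norm_pow]
      gcongr
      · rw [Real.norm_eq_abs, abs_sub_comm, abs_of_nonneg (by linarith [hs.2])]; linarith [hs.1]
      · refine (auxE_norm S hc l x s).trans ?_
        have : Real.exp (-(l.re * s)) ≤ 1 := by
          rw [Real.exp_le_one_iff]
          have := mul_pos hl hs.1
          linarith
        calc _ ≤ 1 * ‖x‖ := by gcongr
          _ = _ := one_mul _)
  refine h.trans (le_of_eq ?_)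
  simp [Measure.real, ht.le]; ring

theorem aux_J2 [CompleteSpace X] (S : ℝ → X →L[ℂ] X) (hS : IsC0Semigroup S)
    (hc : ∀ t, 0 ≤ t → ‖S t‖ ≤ 1) (ε : ℝ) (hε : 0 < ε) (hε1 : ε ≤ 1) (t : ℝ) (ht : 0 < t)
    (hup : ∀ x, ‖x - S t x‖ ≤ (2 - ε) * ‖x‖) (l : ℂ) (hl : 0 < l.re) (c : ℝ) (hc0 : 0 ≤ c)
    (hc1 : c ≤ 1) (hlc : Complex.exp (-(l * t)) = -(c : ℂ)) (x : X) :
    ‖∫ s in Set.Ioi (0 : ℝ), (s ^ 2 : ℝ) • auxE S l x s‖ ≤ 6 * (t / ε) ^ 3 * ‖x‖ := by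
  have low : ∀ y : X, ε * ‖y‖ ≤ ‖y - Complex.exp (-(l * t)) • S t y‖ := by
    intro y
    rw [hlc]
    have e1 : ((1 + c : ℝ) : ℂ) • y = (y - (-(c : ℂ)) • S t y) + (c : ℂ) • (y - S t y) := by
      rw [smul_sub]; push_cast; rw [add_smul, one_smul, neg_smul]; abel
    have e2 : (1 + c) * ‖y‖ ≤ ‖y - (-(c : ℂ)) • S t y‖ + c * ((2 - ε) * ‖y‖) := by
      calc (1 + c) * ‖y‖ = ‖((1 + c : ℝ) : ℂ) • y‖ := by
            rw [norm_smul, Complex.norm_real, Real.norm_of_nonneg (by linarith)]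
        _ ≤ _ := by
            rw [e1]
            refine (norm_add_le _ _).trans ?_
            rw [norm_smul _ (y - S t y), Complex.norm_real, Real.norm_of_nonneg hc0]
            gcongr
            exact hup y
    nlinarith [mul_nonneg (mul_nonneg (sub_nonneg.2 hc1) (sub_nonneg.2 hε1)) (norm_nonneg y)]
  have i0 := auxE_int S hS hc l hl x 0
  have i1 := auxE_int S hS hc l hl x 1
  have i2 := auxE_int S hS hc l hl x 2
  set J0 := ∫ s in Set.Ioi (0 : ℝ), (s ^ 0 : ℝ) • auxE S l x s with hJ0
  set J1 := ∫ s in Set.Ioi (0 : ℝ), (s ^ 1 : ℝ) • auxE S l x s with hJ1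
  set J2 := ∫ s in Set.Ioi (0 : ℝ), (s ^ 2 : ℝ) • auxE S l x s with hJ2
  have f0 : (fun s : ℝ => ((s - t) ^ 0 : ℝ) • auxE S l x s) =
    fun s : ℝ => (s ^ 0 : ℝ) • auxE S l x s := by ext; simp
  have f1 : (fun s : ℝ => ((s - t) ^ 1 : ℝ) • auxE S l x s) =
    fun s : ℝ => (s ^ 1 : ℝ) • auxE S l x s - t • (s ^ 0 : ℝ) • auxE S l x s := by
    ext s; rw [smul_smul, ← sub_smul]; congr 1; ring
  have f2 : (fun s : ℝ => ((s - t) ^ 2 : ℝ) • auxE S l x s) =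
    fun s : ℝ => (s ^ 2 : ℝ) • auxE S l x s - (2 * t) • (s ^ 1 : ℝ) • auxE S l x s
      + (t ^ 2) • (s ^ 0 : ℝ) • auxE S l x s := by
    ext s; rw [smul_smul, smul_smul, ← sub_smul, ← add_smul]; congr 1; ring
  have i1' : IntegrableOn (fun s : ℝ => t • (s ^ 0 : ℝ) • auxE S l x s) (Set.Ioi 0) := i0.smul t
  have i2' : IntegrableOn (fun s : ℝ => (2 * t) • (s ^ 1 : ℝ) • auxE S l x s) (Set.Ioi 0) :=
    i1.smul (2 * t)
  have i3' : IntegrableOn (fun s : ℝ => (t ^ 2) • (s ^ 0 : ℝ) • auxE S l x s) (Set.Ioi 0) :=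
    i0.smul (t ^ 2)
  have s0 := aux_shift S hS hc l hl x 0 t ht (by rw [f0]; exact i0)
  have s1 := aux_shift S hS hc l hl x 1 t ht (by rw [f1]; exact i1.sub i1')
  have s2 := aux_shift S hS hc l hl x 2 t ht (by rw [f2]; exact (i2.sub i2').add i3')
  have g0 : ∫ s in Set.Ioi (0 : ℝ), ((s - t) ^ 0 : ℝ) • auxE S l x s = J0 := by rw [f0]
  have g1 : ∫ s in Set.Ioi (0 : ℝ), ((s - t) ^ 1 : ℝ) • auxE S l x s = J1 - t • J0 := by
    rw [f1, integral_sub i1 i1', integral_smul]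
  have g2 : ∫ s in Set.Ioi (0 : ℝ), ((s - t) ^ 2 : ℝ) • auxE S l x s =
      J2 - (2 * t) • J1 + (t ^ 2) • J0 := by
    have i4 : IntegrableOn (fun s : ℝ => (s ^ 2 : ℝ) • auxE S l x s -
        (2 * t) • (s ^ 1 : ℝ) • auxE S l x s) (Set.Ioi 0) := i2.sub i2'
    rw [f2, integral_add i4 i3', integral_sub i2 i2', integral_smul, integral_smul]
  rw [g0] at s0
  rw [g1] at s1
  rw [g2] at s2
  have b0 := aux_Ebound S hc l hl x 0 t ht
  have b1 := aux_Ebound S hc l hl x 1 t ht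
  have b2 := aux_Ebound S hc l hl x 2 t ht
  have l0 := low J0
  have l1 := low J1
  have l2 := low J2
  rw [s0] at l0
  rw [s1] at l1
  rw [s2] at l2
  set E0 := ∫ s in Set.Ioc (0 : ℝ) t, ((s - t) ^ 0 : ℝ) • auxE S l x s
  set E1 := ∫ s in Set.Ioc (0 : ℝ) t, ((s - t) ^ 1 : ℝ) • auxE S l x s
  set E2 := ∫ s in Set.Ioc (0 : ℝ) t, ((s - t) ^ 2 : ℝ) • auxE S l x s
  have m0 : ε * ‖J0‖ ≤ t * ‖x‖ := by
    have : J0 - (J0 - E0) = E0 := by abel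
    rw [this] at l0
    simpa using l0.trans b0
  have m1 : ε * ‖J1‖ ≤ t * ‖J0‖ + t ^ 2 * ‖x‖ := by
    have : J1 - (J1 - t • J0 - E1) = t • J0 + E1 := by abel
    rw [this] at l1
    have := norm_add_le (t • J0) E1
    rw [norm_smul, Real.norm_of_nonneg ht.le] at this
    norm_num at b1
    linarith
  have m2 : ε * ‖J2‖ ≤ 2 * t * ‖J1‖ + t ^ 2 * ‖J0‖ + t ^ 3 * ‖x‖ := by
    have : J2 - (J2 - (2 * t) • J1 + (t ^ 2) • J0 - E2) = (2 * t) • J1 - (t ^ 2) • J0 + E2 := by abel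
    rw [this] at l2
    have h1 := norm_add_le ((2 * t) • J1 - (t ^ 2) • J0) E2
    have h2 := norm_sub_le ((2 * t) • J1) ((t ^ 2) • J0)
    rw [norm_smul, norm_smul, Real.norm_of_nonneg (by positivity),
      Real.norm_of_nonneg (by positivity)] at h2
    norm_num at b2
    linarith
  have hx := norm_nonneg x
  have n1 : ε ^ 2 * ‖J1‖ ≤ 2 * t ^ 2 * ‖x‖ := by
    calc ε ^ 2 * ‖J1‖ = ε * (ε * ‖J1‖) := by ring
      _ ≤ ε * (t * ‖J0‖ + t ^ 2 * ‖x‖) := by gcongr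
      _ = t * (ε * ‖J0‖) + ε * (t ^ 2 * ‖x‖) := by ring
      _ ≤ t * (t * ‖x‖) + 1 * (t ^ 2 * ‖x‖) := by gcongr
      _ = _ := by ring
  have n2 : ε ^ 3 * ‖J2‖ ≤ 6 * t ^ 3 * ‖x‖ := by
    calc ε ^ 3 * ‖J2‖ = ε ^ 2 * (ε * ‖J2‖) := by ring
      _ ≤ ε ^ 2 * (2 * t * ‖J1‖ + t ^ 2 * ‖J0‖ + t ^ 3 * ‖x‖) := by gcongr
      _ = 2 * t * (ε ^ 2 * ‖J1‖) + ε * (t ^ 2 * (ε * ‖J0‖)) + ε ^ 2 * (t ^ 3 * ‖x‖) := by ring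
      _ ≤ 2 * t * (2 * t ^ 2 * ‖x‖) + 1 * (t ^ 2 * (t * ‖x‖)) + 1 * (t ^ 3 * ‖x‖) := by
          gcongr
          exact pow_le_one₀ hε.le hε1
      _ = _ := by ring
  rw [div_pow, mul_div_assoc', div_mul_eq_mul_div, le_div_iff₀ (by positivity)]
  linarith

/-- combined bound -/
theorem aux_J2_comb [CompleteSpace X] (S : ℝ → X →L[ℂ] X) (hS : IsC0Semigroup S)
    (hc : ∀ t, 0 ≤ t → ‖S t‖ ≤ 1) (ε : ℝ) (hε : 0 < ε) (hε1 : ε ≤ 1) (δ : ℝ) (hδ : 0 < δ)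
    (hup : ∀ t, 0 < t → t < δ → ∀ x, ‖x - S t x‖ ≤ (2 - ε) * ‖x‖) (a : ℝ) (ha : 1 / δ < a)
    (y : ℝ) (x : X) :
    (a + |y|) * ‖∫ s in Set.Ioi (0 : ℝ), (s ^ 2 : ℝ) • auxE S (a + y * Complex.I) x s‖ ≤
      24 * (Real.pi / ε) ^ 3 / (a ^ 2 + y ^ 2) * ‖x‖ := by
  have ha0 : 0 < a := lt_trans (by positivity) ha
  have hre : ((a : ℂ) + y * Complex.I).re = a := by simp
  have hpi : 3 < Real.pi := Real.pi_gt_three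
  have hx := norm_nonneg x
  have hP : 0 < a ^ 2 + y ^ 2 := by positivity
  have hpε : Real.pi ≤ Real.pi / ε := by
    rw [le_div_iff₀ hε]; nlinarith
  set N := ‖∫ s in Set.Ioi (0 : ℝ), (s ^ 2 : ℝ) • auxE S (a + y * Complex.I) x s‖ with hN
  have hN0 : 0 ≤ N := norm_nonneg _
  rw [div_mul_eq_mul_div, le_div_iff₀ hP]
  rcases lt_or_ge |y| (Real.pi * a) with h | h
  · have h1 := aux_J2_triv S hc (a + y * Complex.I) (by rw [hre]; exact ha0) x
    rw [hre, ← hN] at h1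
    have hy2 : y ^ 2 ≤ Real.pi ^ 2 * a ^ 2 := by
      rw [← sq_abs, ← mul_pow]; gcongr
    calc (a + |y|) * N * (a ^ 2 + y ^ 2)
        ≤ (a + Real.pi * a) * (2 / a ^ 3 * ‖x‖) * (a ^ 2 + Real.pi ^ 2 * a ^ 2) := by gcongr
      _ = 2 * ((1 + Real.pi) * (1 + Real.pi ^ 2)) * ‖x‖ := by field_simp
      _ ≤ 2 * (12 * Real.pi ^ 3) * ‖x‖ := by
          have h5 : (1 + Real.pi) * (1 + Real.pi ^ 2) ≤ 12 * Real.pi ^ 3 := by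
            have h6 : 1 + Real.pi ≤ 2 * Real.pi := by linarith
            have h7 : 1 + Real.pi ^ 2 ≤ 2 * Real.pi ^ 2 := by nlinarith
            calc (1 + Real.pi) * (1 + Real.pi ^ 2) ≤ (2 * Real.pi) * (2 * Real.pi ^ 2) := by gcongr
              _ = 4 * Real.pi ^ 3 := by ring
              _ ≤ _ := by gcongr; norm_num
          exact mul_le_mul_of_nonneg_right (by linarith) hx
      _ ≤ 2 * (12 * (Real.pi / ε) ^ 3) * ‖x‖ := by gcongr
      _ = _ := by ring
  · have hy0 : 0 < |y| := lt_of_lt_of_le (by positivity) h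
    set t := Real.pi / |y| with ht
    have ht0 : 0 < t := by positivity
    have hta : t ≤ 1 / a := by
      rw [ht, div_le_div_iff₀ hy0 ha0]; linarith
    have htδ : t < δ := by
      refine hta.trans_lt ?_
      rw [div_lt_iff₀ ha0]
      rw [div_lt_iff₀ hδ] at ha; linarith
    have hexp : Complex.exp (-((a + y * Complex.I) * t)) = -((Real.exp (-(a * t)) : ℝ) : ℂ) := by
      have hyt : y * t = Real.pi ∨ y * t = -Real.pi := by
        rw [ht]
        rcases lt_or_gt_of_ne (abs_pos.1 hy0) with h | h
        · right; rw [abs_of_neg h]; have := h.ne; field_simp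
        · left; rw [abs_of_pos h]; field_simp
      have e : -(((a : ℂ) + y * Complex.I) * t) = ((-(a * t) : ℝ) : ℂ) + -(((y * t : ℝ) : ℂ) * Complex.I) := by
        push_cast; ring
      rw [e, Complex.exp_add, ← Complex.ofReal_exp]
      rcases hyt with h | h <;> rw [h]
      · rw [Complex.exp_neg, Complex.exp_pi_mul_I]; norm_num
      · rw [Complex.ofReal_neg, neg_mul, neg_neg, Complex.exp_pi_mul_I]; ring
    have h1 := aux_J2 S hS hc ε hε hε1 t ht0 (hup t ht0 htδ) (a + y * Complex.I)
      (by rw [hre]; exact ha0) (Real.exp (-(a * t))) (Real.exp_pos _).le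
      (by rw [Real.exp_le_one_iff]; have := mul_pos ha0 ht0; linarith) hexp x
    rw [← hN] at h1
    have hay : a ≤ |y| := by nlinarith
    have ha2 : a ^ 2 + y ^ 2 ≤ 2 * |y| ^ 2 := by
      have : a ^ 2 ≤ |y| ^ 2 := by gcongr
      rw [sq_abs] at this ⊢; linarith
    calc (a + |y|) * N * (a ^ 2 + y ^ 2)
        ≤ (|y| + |y|) * (6 * (t / ε) ^ 3 * ‖x‖) * (2 * |y| ^ 2) := by gcongr
      _ = _ := by rw [ht]; field_simp; ring

end Helpers2

section Helpers3
variable {X : Type*} [NormedAddCommGroup X] [NormedSpace ℂ X]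
open scoped FourierTransform

theorem aux_lorentz (a : ℝ) (ha : 0 < a) :
    Integrable (fun v : ℝ => (a ^ 2 + (2 * Real.pi * v) ^ 2)⁻¹) ∧
    ∫ v : ℝ, (a ^ 2 + (2 * Real.pi * v) ^ 2)⁻¹ = 1 / (2 * a) := by
  have hpi := Real.pi_pos
  have hb : 2 * Real.pi / a ≠ 0 := by positivity
  have e : (fun v : ℝ => (a ^ 2 + (2 * Real.pi * v) ^ 2)⁻¹) =
      fun v : ℝ => (a ^ 2)⁻¹ * (1 + ((2 * Real.pi / a) * v) ^ 2)⁻¹ := by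
    ext v
    rw [← mul_inv]; congr 1; field_simp
  rw [e]
  constructor
  · exact ((integrable_inv_one_add_sq).comp_mul_left' hb).const_mul _
  · rw [integral_const_mul, Measure.integral_comp_mul_left (fun v : ℝ => (1 + v ^ 2)⁻¹),
      integral_univ_inv_one_add_sq, abs_of_pos (by positivity), smul_eq_mul]
    field_simp

theorem aux_G_deriv [CompleteSpace X] (S : ℝ → X →L[ℂ] X) (hS : IsC0Semigroup S)
    (hc : ∀ t, 0 ≤ t → ‖S t‖ ≤ 1) (ε : ℝ) (hε : 0 < ε) (hε1 : ε ≤ 1) (δ : ℝ) (hδ : 0 < δ)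
    (hup : ∀ t, 0 < t → t < δ → ∀ x, ‖x - S t x‖ ≤ (2 - ε) * ‖x‖) (a : ℝ) (ha : 1 / δ < a)
    (x : X) (t : ℝ) :
    ∃ y : X, HasDerivAt (fun s : ℝ => ((max s 0) ^ 2 : ℝ) • auxE S a x s) y t ∧
      ‖y‖ ≤ 24 * (Real.pi / ε) ^ 3 * ‖x‖ * (1 / (2 * a)) := by
  have ha0 : 0 < a := lt_trans (by positivity) ha
  set G : ℝ → X := fun s : ℝ => ((max s 0) ^ 2 : ℝ) • auxE S a x s with hG
  have hGc : Continuous G := by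
    have := auxE_cont S hS hc a x
    rw [hG]; fun_prop
  have hGind : G = (Set.Ioi (0 : ℝ)).indicator (fun s : ℝ => (s ^ 2 : ℝ) • auxE S a x s) := by
    ext s
    rcases lt_or_ge 0 s with h | h
    · rw [Set.indicator_of_mem (Set.mem_Ioi.2 h), hG]; simp only [max_eq_left h.le]
    · rw [Set.indicator_of_notMem (by simpa using h), hG]; simp [max_eq_right h]
  have hGi : Integrable G := by
    rw [hGind, integrable_indicator_iff measurableSet_Ioi]
    exact auxE_int S hS hc a (by simpa using ha0) x 2
  have hF : ∀ v : ℝ, 𝓕 G v = ∫ s in Set.Ioi (0 : ℝ), (s ^ 2 : ℝ) •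
      auxE S (a + ((2 * Real.pi * v : ℝ) : ℂ) * Complex.I) x s := by
    intro v
    rw [Real.fourier_real_eq_integral_exp_smul, ← integral_indicator measurableSet_Ioi, hGind]
    congr 1
    ext s
    by_cases h : s ∈ Set.Ioi (0 : ℝ)
    · rw [Set.indicator_of_mem h, Set.indicator_of_mem h, smul_comm]
      congr 1
      simp only [auxE]
      rw [smul_smul, ← Complex.exp_add]
      congr 2
      push_cast; ring
    · rw [Set.indicator_of_notMem h, Set.indicator_of_notMem h, smul_zero]
  set K : ℝ := 24 * (Real.pi / ε) ^ 3 with hK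
  have hbd : ∀ v : ℝ, (a + |2 * Real.pi * v|) * ‖𝓕 G v‖ ≤
      K * ‖x‖ * (a ^ 2 + (2 * Real.pi * v) ^ 2)⁻¹ := by
    intro v
    rw [hF]
    refine (aux_J2_comb S hS hc ε hε hε1 δ hδ hup a ha (2 * Real.pi * v) x).trans (le_of_eq ?_)
    rw [hK]; field_simp
  obtain ⟨hL, hL2⟩ := aux_lorentz a ha0
  have hFc : Continuous (𝓕 G) := VectorFourier.fourierIntegral_continuous Real.continuous_fourierChar
    (innerSL ℝ).continuous₂ hGi
  have hFi : Integrable (𝓕 G) := by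
    refine Integrable.mono' ((hL.const_mul (K * ‖x‖)).const_mul a⁻¹) hFc.aestronglyMeasurable ?_
    refine Eventually.of_forall fun v => ?_
    rw [← div_eq_inv_mul, le_div_iff₀ ha0]
    refine le_trans ?_ (hbd v)
    rw [mul_comm]
    gcongr
    have := abs_nonneg (2 * Real.pi * v)
    linarith
  have hb2 : ∀ v : ℝ, ‖(-2 * Real.pi * Complex.I * v) • 𝓕 G v‖ ≤
      K * ‖x‖ * (a ^ 2 + (2 * Real.pi * v) ^ 2)⁻¹ := by
    intro v
    refine le_trans ?_ (hbd v)
    rw [norm_smul]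
    gcongr
    have : ‖(-2 * Real.pi * Complex.I * v : ℂ)‖ = |2 * Real.pi * v| := by
      simp [abs_mul]
    rw [this]; linarith
  have hFi2 : Integrable (fun v : ℝ => v • 𝓕 G v) := by
    refine Integrable.mono' (hL.const_mul (K * ‖x‖))
      (by fun_prop : Continuous (fun v : ℝ => v • 𝓕 G v)).aestronglyMeasurable ?_
    refine Eventually.of_forall fun v => ?_
    refine le_trans ?_ (hbd v)
    rw [norm_smul]
    gcongr
    rw [abs_mul, abs_of_pos Real.two_pi_pos, Real.norm_eq_abs]
    have := abs_nonneg v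
    nlinarith [Real.pi_gt_three]
  have hinv : G = fun v : ℝ => 𝓕 (𝓕 G) (-v) := by
    have h := hGc.fourierInv_fourier_eq hGi hFi
    rw [← h]
    ext v
    rw [Real.fourierInv_eq_fourier_neg, h]
  have hd := (Real.hasDerivAt_fourier hFi hFi2 (-t)).scomp t (hasDerivAt_neg t)
  refine ⟨(-1 : ℝ) • 𝓕 (fun v : ℝ => (-2 * Real.pi * Complex.I * v) • 𝓕 G v) (-t), ?_, ?_⟩
  · exact hd.congr_of_eventuallyEq (Eventually.of_forall fun v => congrFun hinv v)
  · rw [neg_one_smul, norm_neg, Real.fourier_real_eq_integral_exp_smul, ← hL2, ← integral_const_mul]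
    refine norm_integral_le_of_norm_le (hL.const_mul (K * ‖x‖)) (Eventually.of_forall fun v => ?_)
    rw [norm_smul, Complex.norm_exp_ofReal_mul_I, one_mul]
    exact hb2 v

theorem aux_deriv [CompleteSpace X] (S : ℝ → X →L[ℂ] X) (hS : IsC0Semigroup S)
    (hc : ∀ t, 0 ≤ t → ‖S t‖ ≤ 1) (ε : ℝ) (hε : 0 < ε) (hε1 : ε ≤ 1) (δ : ℝ) (hδ : 0 < δ)
    (hup : ∀ t, 0 < t → t < δ → ∀ x, ‖x - S t x‖ ≤ (2 - ε) * ‖x‖) :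
    ∃ C : ℝ, 1 ≤ C ∧ ∀ t, 0 < t → ∀ x : X, ∃ y : X,
      HasDerivAt (fun s : ℝ => Real.exp (-(1 / δ * s)) • S s x) y t ∧ ‖y‖ ≤ C / t * ‖x‖ := by
  set K : ℝ := 24 * (Real.pi / ε) ^ 3 with hK
  have hK0 : 0 < K := by have := Real.pi_pos; positivity
  have he1 : 1 ≤ Real.exp 1 := Real.one_le_exp zero_le_one
  refine ⟨Real.exp 1 * (K + 1), by nlinarith, fun t ht x => ?_⟩
  set a : ℝ := 1 / δ + 1 / t with ha
  have hta : 0 < 1 / t := by positivity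
  have hda : 0 < 1 / δ := by positivity
  have ha0 : 0 < a := by positivity
  obtain ⟨y, hy, hyb⟩ := aux_G_deriv S hS hc ε hε hε1 δ hδ hup a (by rw [ha]; linarith) x t
  set G : ℝ → X := fun s : ℝ => ((max s 0) ^ 2 : ℝ) • auxE S a x s with hG
  have hphi : HasDerivAt (fun s : ℝ => (s ^ 2)⁻¹ * Real.exp (s / t))
      (-(2 * t) / (t ^ 2) ^ 2 * Real.exp (t / t) + (t ^ 2)⁻¹ * (Real.exp (t / t) * (1 / t))) t := by
    have h1 : HasDerivAt (fun s : ℝ => (s ^ 2)⁻¹) (-(2 * t) / (t ^ 2) ^ 2) t := by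
      have := (hasDerivAt_pow 2 t).fun_inv (by positivity)
      simpa using this
    have h2 : HasDerivAt (fun s : ℝ => Real.exp (s / t)) (Real.exp (t / t) * (1 / t)) t :=
      ((hasDerivAt_id t).div_const t).exp
    exact h1.mul h2
  have heq : (fun s : ℝ => Real.exp (-(1 / δ * s)) • S s x) =ᶠ[𝓝 t]
      fun s : ℝ => ((s ^ 2)⁻¹ * Real.exp (s / t)) • G s := by
    filter_upwards [lt_mem_nhds ht] with s hs
    simp only [hG, auxE, max_eq_left hs.le]
    rw [smul_smul, ← Complex.coe_smul, ← Complex.coe_smul, smul_smul]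
    congr 1
    have h1 : Complex.exp (-((a : ℂ) * s)) = ((Real.exp (-(a * s)) : ℝ) : ℂ) := by push_cast; rfl
    rw [h1, ← Complex.ofReal_mul]
    congr 1
    have h2 : Real.exp (-(1 / δ * s)) = Real.exp (s / t) * Real.exp (-(a * s)) := by
      rw [← Real.exp_add]; congr 1; rw [ha]; ring
    rw [h2]; field_simp
  have hder := (hphi.smul hy).congr_of_eventuallyEq heq
  refine ⟨_, hder, ?_⟩
  have htt : t / t = 1 := div_self ht.ne'
  have hGn : ‖G t‖ ≤ t ^ 2 * ‖x‖ := by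
    simp only [hG, max_eq_left ht.le]
    rw [norm_smul, Real.norm_of_nonneg (by positivity)]
    gcongr
    refine (auxE_norm S hc a x t).trans ?_
    have : Real.exp (-((a : ℂ).re * t)) ≤ 1 := by
      rw [Real.exp_le_one_iff, Complex.ofReal_re]
      have := mul_pos ha0 ht; linarith
    calc _ ≤ 1 * ‖x‖ := by gcongr
      _ = _ := one_mul _
  have hyb2 : ‖y‖ ≤ K * ‖x‖ * t := by
    refine hyb.trans ?_
    gcongr
    rw [div_le_iff₀ (by positivity), ha]
    have : t * (2 * (1 / δ + 1 / t)) = 2 * (t * (1 / δ)) + 2 := by field_simp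
    rw [this]
    have := mul_pos ht hda
    linarith
  rw [htt]
  have hco : -(2 * t) / (t ^ 2) ^ 2 * Real.exp 1 + (t ^ 2)⁻¹ * (Real.exp 1 * (1 / t)) =
    -(Real.exp 1 / t ^ 3) := by field_simp; ring
  rw [hco]
  refine (norm_add_le _ _).trans ?_
  rw [norm_smul, norm_smul, norm_neg, Real.norm_of_nonneg (by positivity),
    Real.norm_of_nonneg (by positivity)]
  calc (t ^ 2)⁻¹ * Real.exp 1 * ‖y‖ + Real.exp 1 / t ^ 3 * ‖G t‖
      ≤ (t ^ 2)⁻¹ * Real.exp 1 * (K * ‖x‖ * t) + Real.exp 1 / t ^ 3 * (t ^ 2 * ‖x‖) := by gcongr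
    _ = _ := by field_simp

end Helpers3

section Helpers4
variable {X : Type*} [NormedAddCommGroup X] [NormedSpace ℂ X]

theorem aux_D (F : ℝ → X →L[ℂ] X) (C : ℝ) (hC : 1 ≤ C)
    (hd : ∀ t, 0 < t → ∀ x : X, ∃ y : X, HasDerivAt (fun s : ℝ => F s x) y t ∧
      ‖y‖ ≤ C / t * ‖x‖) :
    ∃ D : ℝ → X →L[ℂ] X, ∀ t, 0 < t → (∀ x, HasDerivAt (fun s : ℝ => F s x) (D t x) t) ∧
      ‖D t‖ ≤ C / t := by
  have key : ∀ t : ℝ, ∃ L : X →L[ℂ] X, 0 < t →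
      (∀ x, HasDerivAt (fun s : ℝ => F s x) (L x) t) ∧ ‖L‖ ≤ C / t := by
    intro t
    by_cases ht : 0 < t
    · choose y hy hyb using hd t ht
      refine ⟨LinearMap.mkContinuous
        { toFun := y
          map_add' := fun a b => ?_
          map_smul' := fun c a => ?_ } (C / t) hyb, fun _ => ⟨fun x => hy x, ?_⟩⟩
      · refine (hy (a + b)).unique ?_
        simpa using (hy a).fun_add (hy b)
      · refine (hy (c • a)).unique ?_
        simpa using (hy a).fun_const_smul c
      · exact LinearMap.mkContinuous_norm_le _ (by positivity) _
    · exact ⟨0, fun h => absurd h ht⟩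
  choose D hD using key
  exact ⟨D, hD⟩

theorem aux_Fpow (F : ℝ → X →L[ℂ] X) (hF : IsC0Semigroup F) (s : ℝ) (hs : 0 ≤ s) (n : ℕ) :
    F s ^ n = F (n * s) := by
  induction n with
  | zero => simp [hF.1]
  | succ n ih =>
    rw [pow_succ, ih, Nat.cast_succ, add_mul, one_mul, hF.2.1 _ _ (by positivity) hs]
    rfl

theorem aux_E (F : ℝ → X →L[ℂ] X) (hF : IsC0Semigroup F) (hc : ∀ t, 0 ≤ t → ‖F t‖ ≤ 1)
    (C : ℝ) (hC : 1 ≤ C)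
    (hd : ∀ t, 0 < t → ∀ x : X, ∃ y : X, HasDerivAt (fun s : ℝ => F s x) y t ∧
      ‖y‖ ≤ C / t * ‖x‖) :
    ∃ E : ℕ → ℝ → X →L[ℂ] X, (∀ t, 0 < t → E 0 t = F t) ∧
      (∀ n t, 0 < t → ∀ x, HasDerivAt (fun s : ℝ => E n s x) (E (n + 1) t x) t) ∧
      (∀ n t, 0 < t → ‖E n t‖ ≤ n.factorial * (Real.exp 1 * C / t) ^ n) ∧
      (∀ n m t s, 0 < t → 0 < s → E n t * E m s = E (n + m) (t + s)) := by
  obtain ⟨D, hD⟩ := aux_D F C hC hd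
  have hmul : ∀ s t, 0 ≤ s → 0 ≤ t → F s * F t = F (s + t) := fun s t hs ht =>
    (hF.2.1 s t hs ht).symm
  have hDF : ∀ t s, 0 < t → 0 ≤ s → D t * F s = D (t + s) := by
    intro t s ht hs
    ext x
    have h1 := (hD (t + s) (by linarith)).1 x
    have h2 : HasDerivAt (fun r : ℝ => F (r + s) x) (D (t + s) x) t := h1.comp_add_const t s
    have h3 := (hD t ht).1 (F s x)
    refine h3.unique (h2.congr_of_eventuallyEq ?_)
    filter_upwards [lt_mem_nhds ht] with r hr
    rw [← hmul r s hr.le hs]; rfl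
  have hFD : ∀ t s, 0 < t → 0 ≤ s → F s * D t = D (t + s) := by
    intro t s ht hs
    ext x
    have h1 := (hD (t + s) (by linarith)).1 x
    have h2 : HasDerivAt (fun r : ℝ => F (r + s) x) (D (t + s) x) t := h1.comp_add_const t s
    have h3 : HasDerivAt (fun r : ℝ => F s (F r x)) (F s (D t x)) t :=
      ((F s).restrictScalars ℝ).hasFDerivAt.comp_hasDerivAt t ((hD t ht).1 x)
    refine h3.unique (h2.congr_of_eventuallyEq ?_)
    filter_upwards [lt_mem_nhds ht] with r hr
    rw [add_comm r s, ← hmul s r hs hr.le]; rfl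
  have hcomm : ∀ t s, 0 < t → 0 ≤ s → Commute (D t) (F s) := fun t s ht hs =>
    (hDF t s ht hs).trans (hFD t s ht hs).symm
  have hmono : ∀ (n : ℕ) (t p q : ℝ), 0 < p → p ≤ q → n * q ≤ t →
      D q ^ n * F (t - n * q) = D p ^ n * F (t - n * p) := by
    intro n t p q hp hpq hq
    have hqp : 0 ≤ q - p := by linarith
    have hn : (0 : ℝ) ≤ n := by positivity
    have e1 : D q = D p * F (q - p) := by
      rw [hDF p (q - p) hp hqp]; congr 1; ring
    rw [e1, (hcomm p (q - p) hp hqp).mul_pow, aux_Fpow F hF _ hqp, mul_assoc,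
      hmul _ _ (by positivity) (by linarith)]
    congr 2; ring
  have hind : ∀ (n : ℕ) (t p q : ℝ), 0 < p → 0 < q → n * p ≤ t → n * q ≤ t →
      D q ^ n * F (t - n * q) = D p ^ n * F (t - n * p) := by
    intro n t p q hp hq h1 h2
    rcases le_total p q with h | h
    · exact hmono n t p q hp h h2
    · exact (hmono n t q p hq h h1).symm
  set E : ℕ → ℝ → X →L[ℂ] X := fun n t =>
    D (t / (n + 1)) ^ n * F (t - n * (t / (n + 1))) with hE
  have hEp : ∀ (n : ℕ) (t p : ℝ), 0 < t → 0 < p → n * p ≤ t →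
      E n t = D p ^ n * F (t - n * p) := by
    intro n t p ht hp h
    refine hind n t p _ hp (by positivity) h ?_
    rw [mul_div_assoc', div_le_iff₀ (by positivity)]
    nlinarith
  refine ⟨E, ?_, ?_, ?_, ?_⟩
  · intro t ht
    simp [hE]
  · intro n t ht x
    set p : ℝ := t / (n + 1) with hp
    have hp0 : 0 < p := by positivity
    have hpt : t - n * p = p := by rw [hp]; field_simp; ring
    have e1 : E (n + 1) t = D p ^ n * D (t - n * p) := by
      rw [hEp (n + 1) t p ht hp0 (by push_cast; linarith), hpt, ← pow_succ]
      have : t - (n + 1 : ℕ) * p = 0 := by push_cast; linarith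
      rw [this, hF.1, mul_one]
    rw [e1]
    have h1 := ((hD (t - n * p) (by rw [hpt]; exact hp0)).1 x).comp_sub_const t (n * p)
    have h3 : HasDerivAt (fun r : ℝ => (D p ^ n) (F (r - n * p) x))
        ((D p ^ n) (D (t - n * p) x)) t :=
      ((D p ^ n).restrictScalars ℝ).hasFDerivAt.comp_hasDerivAt t h1
    refine h3.congr_of_eventuallyEq ?_
    filter_upwards [lt_mem_nhds ht, lt_mem_nhds (show n * p < t by linarith)] with r hr hr2
    rw [hEp n r p hr hp0 hr2.le]; rfl
  · intro n t ht
    rcases Nat.eq_zero_or_pos n with rfl | hn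
    · simpa [hE] using hc t ht.le
    · have hn' : (0 : ℝ) < n := by exact_mod_cast hn
      have e : n * (t / n) = t := by field_simp
      rw [hEp n t (t / n) ht (by positivity) e.le, e, sub_self, hF.1, mul_one]
      refine (norm_pow_le' _ hn).trans ?_
      have h1 := (hD (t / n) (by positivity)).2
      calc ‖D (t / n)‖ ^ n ≤ (C / (t / n)) ^ n := by gcongr
        _ = (n : ℝ) ^ n / n.factorial * (n.factorial * (C / t) ^ n) := by
            have : C / (t / n) = n * (C / t) := by field_simp
            rw [this, mul_pow]; field_simp
        _ ≤ Real.exp n * (n.factorial * (C / t) ^ n) := by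
            gcongr
            exact Real.pow_div_factorial_le_exp n hn'.le n
        _ = _ := by
            rw [mul_div_assoc, mul_pow, ← Real.exp_nat_mul, mul_one]; ring
  · intro n m t s ht hs
    set p : ℝ := min (t / (n + 1)) (s / (m + 1)) with hp
    have hp0 : 0 < p := lt_min (by positivity) (by positivity)
    have h1 : n * p ≤ t := by
      have : p ≤ t / (n + 1) := min_le_left _ _
      rw [le_div_iff₀ (by positivity)] at this
      linarith
    have h2 : m * p ≤ s := by
      have : p ≤ s / (m + 1) := min_le_right _ _
      rw [le_div_iff₀ (by positivity)] at this
      linarith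
    rw [hEp n t p ht hp0 h1, hEp m s p hs hp0 h2,
      hEp (n + m) (t + s) p (by positivity) hp0 (by push_cast; linarith)]
    have hcc := ((hcomm p (t - n * p) hp0 (by linarith)).pow_left m).eq
    calc _ = D p ^ n * (F (t - n * p) * D p ^ m) * F (s - m * p) := by noncomm_ring
      _ = D p ^ n * D p ^ m * (F (t - n * p) * F (s - m * p)) := by rw [← hcc]; noncomm_ring
      _ = _ := by
        rw [hmul _ _ (by linarith) (by linarith), pow_add]
        congr 2; push_cast; ring

/-- Taylor series of the semigroup around `t`. -/
def auxP (E : ℕ → ℝ → X →L[ℂ] X) (t : ℝ) (z : ℂ) : X →L[ℂ] X :=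
  ∑' n : ℕ, ((z - t) ^ n / (n.factorial : ℂ)) • E n t

theorem auxP_term (E : ℕ → ℝ → X →L[ℂ] X) (B : ℝ) (hB : 0 < B)
    (hE : ∀ n t, 0 < t → ‖E n t‖ ≤ n.factorial * (B / t) ^ n) (t : ℝ) (ht : 0 < t) (z : ℂ)
    (hz : ‖z - t‖ ≤ 1 / (2 * B) * t) (n : ℕ) :
    ‖((z - t) ^ n / (n.factorial : ℂ)) • E n t‖ ≤ (1 / 2 : ℝ) ^ n := by
  rw [norm_smul, norm_div, norm_pow, Complex.norm_natCast]
  calc ‖z - t‖ ^ n / n.factorial * ‖E n t‖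
      ≤ (1 / (2 * B) * t) ^ n / n.factorial * (n.factorial * (B / t) ^ n) := by
        gcongr; exact hE n t ht
    _ = ((1 / (2 * B) * t) * (B / t)) ^ n := by
        generalize 1 / (2 * B) * t = u; generalize B / t = v
        rw [mul_pow]; field_simp
    _ = _ := by congr 1; field_simp

theorem auxP_norm [CompleteSpace X] (E : ℕ → ℝ → X →L[ℂ] X) (B : ℝ) (hB : 0 < B)
    (hE : ∀ n t, 0 < t → ‖E n t‖ ≤ n.factorial * (B / t) ^ n) (t : ℝ) (ht : 0 < t) (z : ℂ)
    (hz : ‖z - t‖ ≤ 1 / (2 * B) * t) : ‖auxP E t z‖ ≤ 2 :=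
  tsum_of_norm_bounded hasSum_geometric_two (auxP_term E B hB hE t ht z hz)

theorem auxP_diff [CompleteSpace X] (E : ℕ → ℝ → X →L[ℂ] X) (B : ℝ) (hB : 0 < B)
    (hE : ∀ n t, 0 < t → ‖E n t‖ ≤ n.factorial * (B / t) ^ n) (t : ℝ) (ht : 0 < t) :
    DifferentiableOn ℂ (auxP E t) (Metric.ball (t : ℂ) (1 / (2 * B) * t)) := by
  refine Complex.differentiableOn_tsum_of_summable_norm (u := fun n => (1 / 2 : ℝ) ^ n)
    summable_geometric_two (fun n => ?_) Metric.isOpen_ball (fun n w hw => ?_)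
  · exact (by fun_prop : Differentiable ℂ
      fun z : ℂ => ((z - t) ^ n / (n.factorial : ℂ)) • E n t).differentiableOn
  · rw [Metric.mem_ball, dist_eq_norm] at hw
    exact auxP_term E B hB hE t ht w hw.le n

theorem auxP_mul [CompleteSpace X] (E : ℕ → ℝ → X →L[ℂ] X) (B : ℝ) (hB : 0 < B)
    (hE : ∀ n t, 0 < t → ‖E n t‖ ≤ n.factorial * (B / t) ^ n)
    (hEm : ∀ n m t s, 0 < t → 0 < s → E n t * E m s = E (n + m) (t + s))
    (t : ℝ) (ht : 0 < t) (z : ℂ) (hz : ‖z - t‖ ≤ 1 / (2 * B) * t)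
    (s : ℝ) (hs : 0 < s) (w : ℂ) (hw : ‖w - s‖ ≤ 1 / (2 * B) * s) :
    auxP E t z * auxP E s w = auxP E (t + s) (z + w) := by
  have s1 := Summable.of_nonneg_of_le (fun n => norm_nonneg _) (auxP_term E B hB hE t ht z hz)
    summable_geometric_two
  have s2 := Summable.of_nonneg_of_le (fun n => norm_nonneg _) (auxP_term E B hB hE s hs w hw)
    summable_geometric_two
  unfold auxP
  rw [tsum_mul_tsum_eq_tsum_sum_antidiagonal_of_summable_norm s1 s2]
  congr 1
  ext1 n
  have e : z + w - ((t + s : ℝ) : ℂ) = (z - t) + (w - s) := by push_cast; ring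
  rw [e, (Commute.all (z - (t : ℂ)) (w - s)).add_pow', Finset.sum_div, Finset.sum_smul]
  refine Finset.sum_congr rfl fun p hp => ?_
  rw [Finset.HasAntidiagonal.mem_antidiagonal] at hp
  rw [smul_mul_smul_comm, hEm _ _ _ _ ht hs, hp]
  congr 1
  rw [← hp, nsmul_eq_mul, Nat.cast_add_choose]
  have h1 : ((p.1).factorial : ℂ) ≠ 0 := by exact_mod_cast Nat.factorial_ne_zero _
  have h2 : ((p.2).factorial : ℂ) ≠ 0 := by exact_mod_cast Nat.factorial_ne_zero _
  have h3 : ((p.1 + p.2).factorial : ℂ) ≠ 0 := by exact_mod_cast Nat.factorial_ne_zero _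
  field_simp

theorem auxP_real [CompleteSpace X] (E : ℕ → ℝ → X →L[ℂ] X) (B : ℝ) (hB : 0 < B)
    (hE : ∀ n t, 0 < t → ‖E n t‖ ≤ n.factorial * (B / t) ^ n)
    (hEd : ∀ n t, 0 < t → ∀ x, HasDerivAt (fun s : ℝ => E n s x) (E (n + 1) t x) t)
    (t : ℝ) (ht : 0 < t) (s : ℝ) (hts : t ≤ s) (hs : s - t ≤ 1 / (2 * B) * t) :
    auxP E t s = E 0 s := by
  have hz : ‖(s : ℂ) - t‖ ≤ 1 / (2 * B) * t := by
    rw [← Complex.ofReal_sub, Complex.norm_real, Real.norm_of_nonneg (by linarith)]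
    exact hs
  have s1 : Summable fun n : ℕ => (((s : ℂ) - t) ^ n / (n.factorial : ℂ)) • E n t :=
    Summable.of_norm_bounded summable_geometric_two (auxP_term E B hB hE t ht s hz)
  ext x
  have hsum := ((ContinuousLinearMap.apply ℂ X x).hasSum s1.hasSum).tendsto_sum_nat
  have hsum' : Tendsto (fun N : ℕ => ∑ n ∈ Finset.range N,
      (((s : ℂ) - t) ^ n / (n.factorial : ℂ)) • E n t x) atTop (𝓝 (auxP E t s x)) := hsum
  refine tendsto_nhds_unique (hsum'.comp (tendsto_add_atTop_nat 1)) ?_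
  set b : ℝ := s + 1 with hb
  have htb : t < b := by linarith
  have hU : UniqueDiffOn ℝ (Set.Icc t b) := uniqueDiffOn_Icc htb
  have hit : ∀ n : ℕ, Set.EqOn (iteratedDerivWithin n (fun r : ℝ => E 0 r x) (Set.Icc t b))
      (fun r => E n r x) (Set.Icc t b) := by
    intro n
    induction n with
    | zero => intro r hr; simp
    | succ n ih =>
      intro r hr
      rw [iteratedDerivWithin_succ, derivWithin_congr ih (ih hr)]
      exact (hEd n r (lt_of_lt_of_le ht hr.1) x).hasDerivWithinAt.derivWithin (hU r hr)
  have hcd : ∀ N : ℕ, ContDiffOn ℝ N (fun r : ℝ => E 0 r x) (Set.Icc t b) := by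
    intro N
    refine contDiffOn_of_differentiableOn_deriv (n := (N : ℕ∞)) fun m _ => ?_
    refine DifferentiableOn.congr ?_ (hit m)
    intro r hr
    exact (hEd m r (lt_of_lt_of_le ht hr.1) x).differentiableAt.differentiableWithinAt
  have htay : ∀ N : ℕ, taylorWithinEval (fun r : ℝ => E 0 r x) N (Set.Icc t b) t s =
      ∑ n ∈ Finset.range (N + 1), (((s : ℂ) - t) ^ n / (n.factorial : ℂ)) • E n t x := by
    intro N
    rw [taylor_within_apply]
    refine Finset.sum_congr rfl fun n _ => ?_
    rw [hit n ⟨le_rfl, htb.le⟩, ← Complex.coe_smul]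
    congr 1
    push_cast; ring
  have hrem : ∀ N : ℕ, ‖E 0 s x - ∑ n ∈ Finset.range (N + 1),
      (((s : ℂ) - t) ^ n / (n.factorial : ℂ)) • E n t x‖ ≤
        ((N + 1 : ℕ) * (1 / 2 : ℝ) ^ (N + 1)) * ‖x‖ := by
    intro N
    have := taylor_mean_remainder_bound (f := fun r : ℝ => E 0 r x) (n := N) (x := s)
      (C := (N + 1).factorial * (B / t) ^ (N + 1) * ‖x‖) htb.le
      (by exact_mod_cast hcd (N + 1)) ⟨hts, by linarith⟩ ?_
    · rw [htay] at this
      refine this.trans ?_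
      have h0 : 0 ≤ s - t := by linarith
      calc _ ≤ (N + 1).factorial * (B / t) ^ (N + 1) * ‖x‖ * (1 / (2 * B) * t) ^ (N + 1) /
            N.factorial := by gcongr
        _ = (N + 1 : ℕ) * ((B / t) * (1 / (2 * B) * t)) ^ (N + 1) * ‖x‖ := by
          generalize 1 / (2 * B) * t = u; generalize B / t = v
          rw [mul_pow, Nat.factorial_succ]; push_cast; field_simp
        _ = _ := by
          congr 3; field_simp
    · intro r hr
      rw [hit (N + 1) hr]
      have hr0 : 0 < r := lt_of_lt_of_le ht hr.1
      refine ((E (N + 1) r).le_opNorm x).trans ?_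
      refine mul_le_mul_of_nonneg_right ((hE (N + 1) r hr0).trans ?_) (norm_nonneg x)
      gcongr
      exact hr.1
  rw [tendsto_iff_norm_sub_tendsto_zero]
  refine squeeze_zero (fun _ => norm_nonneg _)
    (g := fun N : ℕ => ((N + 1 : ℕ) * (1 / 2 : ℝ) ^ (N + 1)) * ‖x‖) (fun N => ?_) ?_
  · rw [norm_sub_rev]; exact hrem N
  · have h := tendsto_self_mul_const_pow_of_lt_one (r := (1 / 2 : ℝ)) (by norm_num) (by norm_num)
    have h2 := (h.comp (tendsto_add_atTop_nat 1)).mul_const ‖x‖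
    rw [zero_mul] at h2
    exact h2

theorem aux_ident {Y : Type*} [NormedAddCommGroup Y] [NormedSpace ℂ Y] [CompleteSpace Y]
    (f g : ℂ → Y) (U : Set ℂ) (hU : IsOpen U) (hUc : IsPreconnected U)
    (hf : DifferentiableOn ℂ f U) (hg : DifferentiableOn ℂ g U) (r : ℝ) (hr : (r : ℂ) ∈ U)
    (h : ∀ᶠ s : ℝ in 𝓝 r, f s = g s) : Set.EqOn f g U := by
  refine (hf.analyticOnNhd hU).eqOn_of_preconnected_of_frequently_eq (hg.analyticOnNhd hU)
    hUc hr ?_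
  have ht : Tendsto (fun s : ℝ => (s : ℂ)) (𝓝[≠] r) (𝓝[≠] (r : ℂ)) := by
    refine tendsto_nhdsWithin_iff.2 ⟨?_, ?_⟩
    · exact (Complex.continuous_ofReal.tendsto r).mono_left nhdsWithin_le_nhds
    · filter_upwards [self_mem_nhdsWithin] with s hs
      simpa using hs
  exact ht.frequently (h.filter_mono nhdsWithin_le_nhds).frequently

end Helpers4

section Helpers5
variable {X : Type*} [NormedAddCommGroup X] [NormedSpace ℂ X]

theorem aux_sector (k : ℝ) (hk : 0 < k) (z : ℂ) (hz : z ∈ Sector (Real.arctan k)) :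
    0 < z.re ∧ |z.im| < k * z.re := by
  obtain ⟨hz0, hz1⟩ := hz
  have hlt : |z.arg| < Real.pi / 2 := hz1.trans (Real.arctan_lt_pi_div_two k)
  have hre : 0 < z.re := by
    rcases Complex.abs_arg_lt_pi_div_two_iff.1 hlt with h | h
    · exact h
    · exact absurd h hz0
  refine ⟨hre, ?_⟩
  rw [abs_lt] at hz1
  have h1 : Real.tan z.arg < k := by
    have := Real.tan_lt_tan_of_lt_of_lt_pi_div_two (by linarith [(abs_lt.1 hlt).1])
      (Real.arctan_lt_pi_div_two k) hz1.2
    rwa [Real.tan_arctan] at this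
  have h2 : -k < Real.tan z.arg := by
    have := Real.tan_lt_tan_of_lt_of_lt_pi_div_two
      (by linarith [Real.arctan_lt_pi_div_two k]) (abs_lt.1 hlt).2 hz1.1
    rwa [Real.tan_neg, Real.tan_arctan] at this
  rw [Complex.tan_arg] at h1 h2
  rw [abs_lt]
  rw [div_lt_iff₀ hre] at h1
  rw [lt_div_iff₀ hre] at h2
  exact ⟨by linarith, h1⟩

theorem aux_hol [CompleteSpace X] (F : ℝ → X →L[ℂ] X) (hF : IsC0Semigroup F)
    (hc : ∀ t, 0 ≤ t → ‖F t‖ ≤ 1) (C : ℝ) (hC : 1 ≤ C)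
    (hd : ∀ t, 0 < t → ∀ x : X, ∃ y : X, HasDerivAt (fun s : ℝ => F s x) y t ∧
      ‖y‖ ≤ C / t * ‖x‖) : IsHolomorphicSemigroup F := by
  obtain ⟨E, hE0, hEd, hEb, hEm⟩ := aux_E F hF hc C hC hd
  set B : ℝ := Real.exp 1 * C with hBdef
  have hB2 : 1 < B := by
    have := Real.one_lt_exp_iff.2 (zero_lt_one' ℝ)
    rw [hBdef]; nlinarith
  have hB : 0 < B := by linarith
  set κ : ℝ := 1 / (2 * B) with hκ
  have hκ0 : 0 < κ := by positivity
  have hκ1 : κ < 1 / 2 := by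
    rw [hκ, div_lt_div_iff₀ (by positivity) (by norm_num)]; linarith
  set q : ℝ := 1 - κ / 4 with hq
  have hq1 : q < 1 := by linarith
  have hq2 : 1 / 2 < q := by linarith
  set W : Set ℂ := {z | 0 < z.re ∧ |z.im| < κ / 4 * z.re} with hW
  have hWo : IsOpen W := by
    refine IsOpen.and (isOpen_lt continuous_const Complex.continuous_re) ?_
    exact isOpen_lt (by fun_prop) (by fun_prop)
  have hSW : Sector (Real.arctan (κ / 4)) ⊆ W := fun z hz =>
    aux_sector (κ / 4) (by positivity) z hz
  set S : ℂ → X →L[ℂ] X := fun z => auxP E (q * z.re) z with hS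
  have hWb : ∀ z ∈ W, ‖z - ((q * z.re : ℝ) : ℂ)‖ < κ * (q * z.re) := by
    rintro z ⟨h1, h2⟩
    refine (Complex.norm_le_abs_re_add_abs_im _).trans_lt ?_
    rw [Complex.sub_re, Complex.sub_im, Complex.ofReal_re, Complex.ofReal_im, sub_zero]
    have : z.re - q * z.re = κ / 4 * z.re := by rw [hq]; ring
    rw [this, abs_of_pos (by positivity)]
    have h3 : κ / 2 * z.re ≤ κ * (q * z.re) := by
      have := mul_pos hκ0 h1
      nlinarith
    linarith
  have hW0 : ∀ z ∈ W, 0 < q * z.re := fun z hz => mul_pos (by linarith) hz.1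
  have hrW : ∀ s : ℝ, 0 < s → (s : ℂ) ∈ W := by
    intro s hs
    refine ⟨by simpa using hs, ?_⟩
    simp only [Complex.ofReal_im, Complex.ofReal_re, abs_zero]
    positivity
  have hSr : ∀ t : ℝ, 0 < t → S t = F t := by
    intro t ht
    rw [← hE0 t ht]
    have h := hWb t (hrW t ht)
    simp only [hS, Complex.ofReal_re] at h ⊢
    have h4 : q * t ≤ t := by nlinarith
    refine auxP_real E B hB hEb hEd (q * t) (by nlinarith) t h4 ?_
    rw [← Complex.ofReal_sub, Complex.norm_real, Real.norm_of_nonneg (by linarith)] at h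
    exact h.le
  have hSm : ∀ z ∈ W, ∀ w ∈ W, S (z + w) = S z * S w := by
    intro z hz w hw
    simp only [hS]
    rw [auxP_mul E B hB hEb hEm _ (hW0 z hz) z (hWb z hz).le _ (hW0 w hw) w (hWb w hw).le,
      Complex.add_re, mul_add]
  have hSn : ∀ z ∈ W, ‖S z‖ ≤ 2 := fun z hz =>
    auxP_norm E B hB hEb _ (hW0 z hz) z (hWb z hz).le
  -- consistency of different expansions
  have hcons : ∀ (t t' : ℝ) (z : ℂ), 0 < t → 0 < t' → t < z.re → t' < z.re →
      z ∈ Metric.ball (t : ℂ) (κ * t) → z ∈ Metric.ball (t' : ℂ) (κ * t') →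
      auxP E t z = auxP E t' z := by
    intro t t' z ht ht' htz htz' h1 h2
    have hre : ∀ a : ℝ, z ∈ Metric.ball (a : ℂ) (κ * a) →
        ((z.re : ℝ) : ℂ) ∈ Metric.ball (a : ℂ) (κ * a) := by
      intro a ha
      rw [Metric.mem_ball, dist_eq_norm] at ha ⊢
      refine lt_of_le_of_lt ?_ ha
      rw [← Complex.ofReal_sub, Complex.norm_real]
      simpa using Complex.abs_re_le_norm (z - a)
    have hopen : ∀ a : ℝ, a < z.re → z ∈ Metric.ball (a : ℂ) (κ * a) → 0 < a →
        ∀ᶠ s : ℝ in 𝓝 z.re, auxP E a s = E 0 s := by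
      intro a haz haz2 ha0
      have h3 : ∀ᶠ s : ℝ in 𝓝 z.re, (s : ℂ) ∈ Metric.ball (a : ℂ) (κ * a) :=
        Complex.continuous_ofReal.continuousAt.eventually_mem
          (Metric.isOpen_ball.mem_nhds (hre a haz2))
      filter_upwards [h3, lt_mem_nhds haz] with s hs hs2
      rw [Metric.mem_ball, dist_eq_norm, ← Complex.ofReal_sub, Complex.norm_real,
        Real.norm_of_nonneg (by linarith)] at hs
      exact auxP_real E B hB hEb hEd a ha0 s hs2.le hs.le
    have hEq := aux_ident (auxP E t) (auxP E t')
      (Metric.ball (t : ℂ) (κ * t) ∩ Metric.ball (t' : ℂ) (κ * t'))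
      (Metric.isOpen_ball.inter Metric.isOpen_ball)
      ((convex_ball _ _).inter (convex_ball _ _)).isPreconnected
      ((auxP_diff E B hB hEb t ht).mono Set.inter_subset_left)
      ((auxP_diff E B hB hEb t' ht').mono Set.inter_subset_right) z.re
      ⟨hre t h1, hre t' h2⟩ (by
        filter_upwards [hopen t htz h1 ht, hopen t' htz' h2 ht'] with s e1 e2
        rw [e1, e2])
    exact hEq ⟨h1, h2⟩
  have hlt : ∀ z ∈ W, q * z.re < z.re := fun z hz => by
    have := hz.1
    nlinarith
  have hSd : ∀ z ∈ W, DifferentiableAt ℂ S z := by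
    intro z hz
    have hzb : z ∈ Metric.ball ((q * z.re : ℝ) : ℂ) (κ * (q * z.re)) := by
      rw [Metric.mem_ball, dist_eq_norm]; exact hWb z hz
    have h1 : DifferentiableAt ℂ (auxP E (q * z.re)) z :=
      (auxP_diff E B hB hEb _ (hW0 z hz)).differentiableAt (Metric.isOpen_ball.mem_nhds hzb)
    refine h1.congr_of_eventuallyEq ?_
    have h2 : ∀ᶠ w in 𝓝 z, q * z.re < w.re :=
      Complex.continuous_re.continuousAt.eventually_const_lt (hlt z hz)
    filter_upwards [hWo.mem_nhds hz, Metric.isOpen_ball.mem_nhds hzb, h2] with w hw1 hw2 hw3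
    refine hcons _ _ w (hW0 w hw1) (hW0 z hz) (hlt w hw1) hw3 ?_ hw2
    rw [Metric.mem_ball, dist_eq_norm]; exact hWb w hw1
  refine ⟨Real.arctan (κ / 4), S, Real.arctan_pos.2 (by positivity), hSr,
    fun z w hz hw => hSm z (hSW hz) w (hSW hw),
    fun z hz => (hSd z (hSW hz)).differentiableWithinAt, fun x => ?_⟩
  rw [Metric.tendsto_nhds]
  intro η hη
  obtain ⟨s, hs0, hs⟩ : ∃ s : ℝ, 0 < s ∧ ‖F s x - x‖ < η / 6 := by
    have h1 := (hF.2.2 x).mono_left (nhdsWithin_mono (0 : ℝ) Set.Ioi_subset_Ici_self)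
    have h2 := (Metric.tendsto_nhds.1 h1 (η / 6) (by positivity)).and self_mem_nhdsWithin
    obtain ⟨s, h3, h4⟩ := h2.exists
    exact ⟨s, h4, by rwa [dist_eq_norm] at h3⟩
  have hcont : Tendsto (fun z : ℂ => S (z + s) x) (𝓝 0) (𝓝 (S s x)) := by
    have h1 : ContinuousAt S (s : ℂ) := (hSd s (hrW s hs0)).continuousAt
    have h2 : Tendsto (fun z : ℂ => z + s) (𝓝 0) (𝓝 (s : ℂ)) := by
      have : Continuous fun z : ℂ => z + s := by fun_prop
      simpa using this.tendsto 0
    exact ((ContinuousLinearMap.apply ℂ X x).continuous.tendsto _).comp (h1.tendsto.comp h2)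
  have h5 := (Metric.tendsto_nhds.1 hcont (η / 3) (by positivity)).filter_mono
    (nhdsWithin_le_nhds (s := Sector (Real.arctan (κ / 4))))
  filter_upwards [h5, self_mem_nhdsWithin] with z hz1 hz2
  have hzW := hSW hz2
  rw [dist_eq_norm, hSm z hzW s (hrW s hs0), hSr s hs0, ContinuousLinearMap.mul_apply] at hz1
  rw [dist_eq_norm]
  have e : S z x - x = -(S z (F s x - x)) + (S z (F s x) - F s x) + (F s x - x) := by
    rw [map_sub]; abel
  have h6 : ‖S z (F s x - x)‖ ≤ 2 * ‖F s x - x‖ :=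
    ((S z).le_opNorm _).trans (by gcongr; exact hSn z hzW)
  rw [e]
  refine (norm_add₃_le).trans_lt ?_
  rw [norm_neg]
  linarith

theorem aux_resc (S : ℝ → X →L[ℂ] X) (a : ℝ)
    (h : IsHolomorphicSemigroup fun s : ℝ => Real.exp (-(a * s)) • S s) :
    IsHolomorphicSemigroup S := by
  obtain ⟨θ, P, hθ, hr, hm, hd, hc⟩ := h
  refine ⟨θ, fun z => Complex.exp (a * z) • P z, hθ, ?_, ?_, ?_, ?_⟩
  · intro t ht
    simp only
    rw [hr t ht]
    simp only
    rw [← Complex.coe_smul, smul_smul]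
    push_cast
    rw [← Complex.exp_add]
    simp
  · intro z w hz hw
    simp only
    rw [hm z w hz hw, mul_add, Complex.exp_add]
    ext x
    simp [smul_smul, mul_comm]
  · exact DifferentiableOn.fun_smul (by fun_prop) hd
  · intro x
    have h1 : Tendsto (fun z : ℂ => Complex.exp (a * z)) (𝓝[Sector θ] 0) (𝓝 1) := by
      have : Continuous fun z : ℂ => Complex.exp (a * z) := by fun_prop
      have h2 := this.tendsto 0
      simp only [mul_zero, Complex.exp_zero] at h2
      exact h2.mono_left nhdsWithin_le_nhds
    simpa using h1.smul (hc x)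

theorem aux_main [CompleteSpace X] (S : ℝ → X →L[ℂ] X) (hS : IsC0Semigroup S)
    (hc : ∀ t, 0 ≤ t → ‖S t‖ ≤ 1) (ε : ℝ) (hε : 0 < ε) (δ : ℝ) (hδ : 0 < δ)
    (hup : ∀ t, 0 < t → t < δ → ∀ x, ‖x - S t x‖ ≤ (2 - ε) * ‖x‖) :
    IsHolomorphicSemigroup S := by
  obtain ⟨C, hC, hd⟩ := aux_deriv S hS hc (min ε 1) (lt_min hε one_pos) (min_le_right _ _) δ hδ
    (fun t ht htd x => (hup t ht htd x).trans (by gcongr; exact min_le_left _ _))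
  refine aux_resc S (1 / δ) (aux_hol _ ⟨?_, ?_, ?_⟩ ?_ C hC hd)
  · simp [hS.1]
  · intro s t hs ht
    simp only
    rw [hS.2.1 s t hs ht, mul_add, neg_add, Real.exp_add]
    ext x
    simp [smul_smul, mul_comm]
  · intro x
    have h1 : Tendsto (fun s : ℝ => Real.exp (-(1 / δ * s))) (𝓝[≥] 0) (𝓝 1) := by
      have : Continuous fun s : ℝ => Real.exp (-(1 / δ * s)) := by fun_prop
      have h2 := this.tendsto 0
      simp only [mul_zero, neg_zero, Real.exp_zero] at h2
      exact h2.mono_left nhdsWithin_le_nhds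
    simpa using h1.smul (hS.2.2 x)
  · intro t ht
    rw [norm_smul, Real.norm_of_nonneg (Real.exp_pos _).le]
    have h1 : Real.exp (-(1 / δ * t)) ≤ 1 := by
      rw [Real.exp_le_one_iff]
      have : 0 ≤ 1 / δ * t := by positivity
      linarith
    exact mul_le_one₀ h1 (norm_nonneg _) (hc t ht)

end Helpers5

end

/-- Let `X` be a uniformly convex complex Banach space and `T` a
one-parameter holomorphic `C₀`-semigroup of contractions on `X` with generator `A`. Then
for every `ψ ∈ 𝒯₁` the operator `ψ(A)` (the generator of the subordinated semigroup
`g(A)`) generates a holomorphic semigroup of contractions. -/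
theorem holomorphic_contractions_subordinated
    {X : Type*} [NormedAddCommGroup X] [NormedSpace ℂ X] [CompleteSpace X]
    [UniformConvexSpace X]
    (T : ℝ → X →L[ℂ] X) (hT : IsC0Semigroup T)
    (hcontr : ∀ t, 0 ≤ t → ‖T t‖ ≤ 1) (hhol : IsHolomorphicSemigroup T)
    (ψ : (Fin 1 → ℝ) → ℝ) (hψ : MemTn 1 ψ)
    (ν : ℝ → MeasureTheory.Measure (Fin 1 → ℝ)) (hν : IsSubordinator 1 ψ ν)
    (g : ℝ → X →L[ℂ] X) (hgsem : IsC0Semigroup g)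
    (hg : ∀ t, 0 ≤ t → ∀ x : X, g t x = ∫ u, T (u 0) x ∂(ν t)) :
    IsHolomorphicSemigroup g ∧ ∀ t, 0 ≤ t → ‖g t‖ ≤ 1 := by

  obtain ⟨hc, ε, hε, δ, hδ, hup⟩ := aux_sub T hT hcontr hhol ψ hψ ν hν g hg
  exact ⟨aux_main g hgsem hc ε hε δ hδ hup, hc⟩
end

section
/- Let A₁,…,Aₙ be pairwise commuting generators of C₀-semigroups T₁,…,Tₙ on a complex Banach space X with ‖Tⱼ(t)‖ ≤ M for all t ≥ 0 and all j, where M ≥ 1. Then for every ψ ∈ T_n and every x ∈ D(A) with ‖x‖ = 1, ‖ψ(A)x‖ ≤ −n·K_M·M^{n−1}·ψ(−‖A₁x‖/n, …, −‖Aₙx‖/n), where K_M = (M+1)/(1 − e^{−(M+1)/M}). -/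
open MeasureTheory Filter Topology

theorem aux_prod {X : Type*} [NormedAddCommGroup X] [NormedSpace ℂ X] (M : ℝ) (hM1 : 1 ≤ M)
    (x : X) : ∀ (n : ℕ) (B : Fin n → X →L[ℂ] X), (∀ j, ‖B j‖ ≤ M) →
    M * ‖(List.ofFn B).prod x - x‖ ≤ M ^ n * ∑ j, ‖B j x - x‖ := by
  intro n
  induction n with
  | zero => intro B _; simp
  | succ k ih =>
    intro B hB
    have h := ih (fun j => B j.succ) (fun j => hB _)
    rw [List.ofFn_succ, List.prod_cons, Fin.sum_univ_succ]
    set P := (List.ofFn fun j => B (Fin.succ j)).prod with hP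
    set S := ∑ j : Fin k, ‖B j.succ x - x‖ with hS
    have e : (B 0 * P) x - x = B 0 (P x - x) + (B 0 x - x) := by
      simp
    have h1 : ‖(B 0 * P) x - x‖ ≤ M * ‖P x - x‖ + ‖B 0 x - x‖ := by
      rw [e]
      refine (norm_add_le _ _).trans ?_
      gcongr
      exact (B 0).le_of_opNorm_le (hB 0) _
    have h2 : (1 : ℝ) ≤ M ^ k := one_le_pow₀ hM1
    have hd := norm_nonneg (B 0 x - x)
    have hM0 : 0 ≤ M := by linarith
    calc M * ‖(B 0 * P) x - x‖ ≤ M * (M ^ k * S + M ^ k * ‖B 0 x - x‖) := by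
          apply mul_le_mul_of_nonneg_left _ hM0
          nlinarith
      _ = _ := by ring

theorem aux_iter {X : Type*} [NormedAddCommGroup X] [NormedSpace ℂ X] (T : ℝ → X →L[ℂ] X)
    (M : ℝ) (hT : IsC0Semigroup T) (hM : ∀ t, 0 ≤ t → ‖T t‖ ≤ M) (x : X) (h : ℝ) (hh : 0 ≤ h)
    (N : ℕ) : ‖T (N * h) x - x‖ ≤ N * (M * ‖T h x - x‖) := by
  induction N with
  | zero => simp [hT.1]
  | succ k ih =>
    have hk : 0 ≤ (k : ℝ) * h := by positivity
    have e : T ((k + 1 : ℕ) * h) x - x = T (k * h) (T h x - x) + (T (k * h) x - x) := by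
      have : ((k + 1 : ℕ) : ℝ) * h = k * h + h := by push_cast; ring
      rw [this, hT.2.1 _ _ hk hh]
      simp
    rw [e]
    refine (norm_add_le _ _).trans ?_
    have := (T (k * h)).le_of_opNorm_le (hM _ hk) (T h x - x)
    push_cast
    linarith

theorem aux_lip {X : Type*} [NormedAddCommGroup X] [NormedSpace ℂ X] (T : ℝ → X →L[ℂ] X)
    (M : ℝ) (hT : IsC0Semigroup T) (hM : ∀ t, 0 ≤ t → ‖T t‖ ≤ M) (x y : X)
    (hy : InGenDomain T x y) (t : ℝ) (ht : 0 ≤ t) : ‖T t x - x‖ ≤ M * (t * ‖y‖) := by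
  rcases ht.eq_or_lt with rfl | ht
  · simp [hT.1]
  have h1 : Tendsto (fun N : ℕ => t / ((N : ℝ) + 1)) atTop (𝓝[>] 0) := by
    refine tendsto_nhdsWithin_iff.2 ⟨?_, Eventually.of_forall fun N => ?_⟩
    · have := (tendsto_one_div_add_atTop_nhds_zero_nat (𝕜 := ℝ)).const_mul t
      simpa [div_eq_mul_inv] using this
    · exact Set.mem_Ioi.2 (by positivity)
  have h2 := ((hy.comp h1).norm.const_mul t).const_mul M
  refine ge_of_tendsto' h2 fun N => ?_
  have h3 := aux_iter T M hT hM x (t / ((N : ℝ) + 1)) (by positivity) (N + 1)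
  have hN : ((N : ℝ) + 1) ≠ 0 := by positivity
  have e : ((N + 1 : ℕ) : ℝ) * (t / ((N : ℝ) + 1)) = t := by push_cast; field_simp
  rw [e] at h3
  refine h3.trans (le_of_eq ?_)
  simp only [Function.comp, norm_smul, norm_inv, Real.norm_eq_abs]
  rw [abs_of_pos (by positivity : 0 < t / ((N : ℝ) + 1))]
  push_cast
  field_simp

theorem aux_den (M : ℝ) (hM1 : 1 ≤ M) : 0 < 1 - Real.exp (-(M + 1) / M) := by
  have : -(M + 1) / M < 0 := div_neg_of_neg_of_pos (by linarith) (by linarith)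
  have := Real.exp_lt_one_iff.2 this
  linarith

theorem aux_KM_one (M : ℝ) (hM1 : 1 ≤ M) : 1 ≤ KM M := by
  rw [KM, le_div_iff₀ (aux_den M hM1)]
  have := Real.exp_pos (-(M + 1) / M)
  linarith

theorem aux_min (M : ℝ) (hM1 : 1 ≤ M) (v : ℝ) (hv : 0 ≤ v) (d : ℝ) (h1 : d ≤ M + 1)
    (h2 : d ≤ M * v) : d ≤ KM M * (1 - Real.exp (-v)) := by
  have hD := aux_den M hM1
  have hM0 : 0 < M := by linarith
  have hK : KM M * (1 - Real.exp (-(M + 1) / M)) = M + 1 := by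
    rw [KM]; exact div_mul_cancel₀ _ hD.ne'
  have hK1 := aux_KM_one M hM1
  rcases le_total v ((M + 1) / M) with hc | hc
  · have hw : 0 < (M + 1) / M := by positivity
    set w := (M + 1) / M with hwdef
    have hb : v / w ≤ 1 := (div_le_one hw).2 hc
    have hcx := convexOn_exp.2 (Set.mem_univ (0 : ℝ)) (Set.mem_univ (-w))
      (sub_nonneg.2 hb) (by positivity : 0 ≤ v / w) (by ring)
    have e : (1 - v / w) • (0 : ℝ) + (v / w) • (-w) = -v := by
      simp only [smul_eq_mul]; field_simp; ring
    rw [e] at hcx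
    simp only [smul_eq_mul, Real.exp_zero] at hcx
    have e2 : -(M + 1) / M = -w := by rw [hwdef]; ring
    rw [e2] at hK
    have e3 : M * v = (v / w) * (M + 1) := by rw [hwdef]; field_simp
    calc d ≤ (v / w) * (KM M * (1 - Real.exp (-w))) := by rw [hK, ← e3]; exact h2
      _ = KM M * ((v / w) * (1 - Real.exp (-w))) := by ring
      _ ≤ _ := by
        apply mul_le_mul_of_nonneg_left _ (by linarith)
        linarith
  · refine h1.trans ?_
    rw [← hK]
    apply mul_le_mul_of_nonneg_left _ (by linarith)
    have : Real.exp (-v) ≤ Real.exp (-(M + 1) / M) := by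
      apply Real.exp_le_exp.2; rw [neg_div]; linarith
    linarith

theorem aux_jensen (n : ℕ) (hn : 0 < n) (v : Fin n → ℝ) :
    ∑ j, (1 - Real.exp (-v j)) ≤ n * (1 - Real.exp (∑ j, -v j / n)) := by
  have hn' : (0 : ℝ) < n := by exact_mod_cast hn
  have h := convexOn_exp.map_sum_le (t := Finset.univ) (w := fun _ : Fin n => (1 : ℝ) / n)
    (p := fun j => -v j) (fun _ _ => by positivity) (by simp; field_simp) (by simp)
  simp only [smul_eq_mul] at h
  rw [← Finset.mul_sum (f := fun j => Real.exp (-v j))] at h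
  have e : ∑ j, 1 / (n : ℝ) * -v j = ∑ j, -v j / n :=
    Finset.sum_congr rfl fun j _ => by ring
  rw [e, one_div, inv_mul_eq_div, le_div_iff₀ hn'] at h
  rw [Finset.sum_sub_distrib]
  simp
  linarith

/-- **moment inequality.** If `A₁,…,Aₙ` are pairwise commuting generators of
`C₀`-semigroups with `‖Tⱼ(t)‖ ≤ M` (`M ≥ 1`), then for every `ψ ∈ 𝒯ₙ` and every
`x ∈ D(A)` with `‖x‖ = 1` (with `Aⱼ x = yⱼ`),
`‖ψ(A)x‖ ≤ -n·K_M·M^{n-1}·ψ(-‖A₁x‖/n, …, -‖Aₙx‖/n)`,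
where `K_M = (M+1)/(1 - e^{-(M+1)/M})` and `ψ(A)x` is given by the representation formula.
(`ψ` is required to be the continuous extension to the closed orthant `(-∞,0]ⁿ`.) -/
theorem moment_inequality
    {X : Type*} [NormedAddCommGroup X] [NormedSpace ℂ X] [CompleteSpace X]
    {n : ℕ} (hn : 0 < n) (T : Fin n → ℝ → X →L[ℂ] X) (M : ℝ) (hM1 : 1 ≤ M)
    (hT : ∀ j, IsC0Semigroup (T j)) (hM : ∀ j t, 0 ≤ t → ‖T j t‖ ≤ M)
    (hcomm : ∀ i j s t, 0 ≤ s → 0 ≤ t → T i s ∘L T j t = T j t ∘L T i s)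
    (ψ : (Fin n → ℝ) → ℝ) (c₀ : ℝ) (c₁ : Fin n → ℝ) (μ : MeasureTheory.Measure (Fin n → ℝ))
    (hψ : MemTn n ψ) (hrep : HasLevyRep n ψ c₀ c₁ μ) (hcont : ContinuousOn ψ (nonposOrthant n))
    (x : X) (hx : ‖x‖ = 1) (y : Fin n → X) (hy : ∀ j, InGenDomain (T j) x (y j)) :
    ‖c₀ • x + (∑ j, c₁ j • y j) + ∫ u, (Tprod T u x - x) ∂μ‖ ≤
      -((n : ℝ) * KM M * M ^ (n - 1) * ψ (fun j => -‖y j‖ / n)) := by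
  obtain ⟨hc0, hc1, hμ, hint, hrepr⟩ := hrep
  have hn' : (0 : ℝ) < n := by exact_mod_cast hn
  have hK1 := aux_KM_one M hM1
  have hM0 : 0 < M := by linarith
  set C : ℝ := (n : ℝ) * KM M * M ^ (n - 1) with hC
  have hP1 : (1 : ℝ) ≤ M ^ (n - 1) := one_le_pow₀ hM1
  have hCn : (n : ℝ) ≤ C := by
    rw [hC, mul_assoc]
    exact le_mul_of_one_le_right hn'.le (one_le_mul_of_one_le_of_one_le hK1 hP1)
  have hC1 : 1 ≤ C := le_trans (by exact_mod_cast hn) hCn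
  have hC0 : 0 ≤ C := by linarith
  have hbound : ∀ u : Fin n → ℝ, (∀ j, 0 ≤ u j) →
      ‖Tprod T u x - x‖ ≤ C * (1 - Real.exp (∑ j, -‖y j‖ / n * u j)) := by
    intro u hu
    have h1 := aux_prod M hM1 x n (fun j => T j (u j)) (fun j => hM j _ (hu j))
    have h2 : ∀ j, ‖T j (u j) x - x‖ ≤ KM M * (1 - Real.exp (-(u j * ‖y j‖))) := by
      intro j
      refine aux_min M hM1 _ (mul_nonneg (hu j) (norm_nonneg _)) _ ?_
        (aux_lip (T j) M (hT j) (hM j) x (y j) (hy j) (u j) (hu j))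
      refine (norm_sub_le _ _).trans ?_
      have := (T j (u j)).le_of_opNorm_le (hM j _ (hu j)) x
      rw [hx] at this ⊢
      linarith
    have h3 : ∑ j, ‖T j (u j) x - x‖ ≤
        KM M * (n * (1 - Real.exp (∑ j, -(u j * ‖y j‖) / n))) := by
      refine (Finset.sum_le_sum fun j _ => h2 j).trans ?_
      rw [← Finset.mul_sum]
      exact mul_le_mul_of_nonneg_left (aux_jensen n hn _) (by linarith)
    have e : ∑ j, -(u j * ‖y j‖) / (n : ℝ) = ∑ j, -‖y j‖ / n * u j :=
      Finset.sum_congr rfl fun j _ => by ring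
    rw [e] at h3
    have e4 : M ^ n = M * M ^ (n - 1) := by
      rw [← pow_succ', Nat.sub_add_cancel hn]
    rw [e4, mul_assoc] at h1
    have h5 := le_of_mul_le_mul_left h1 hM0
    refine h5.trans ((mul_le_mul_of_nonneg_left h3 (by linarith)).trans (le_of_eq ?_))
    rw [hC]; ring
  have key : ∀ ε : ℝ, 0 < ε →
      ‖c₀ • x + (∑ j, c₁ j • y j) + ∫ u, (Tprod T u x - x) ∂μ‖ ≤
        -(C * ψ (fun j => -‖y j‖ / n - ε)) := by
    intro ε hε
    have hs : (fun j => -‖y j‖ / n - ε) ∈ negOrthant n := by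
      intro j
      have : 0 ≤ ‖y j‖ / n := by positivity
      simp only [neg_div]
      linarith
    have hi := hint _ hs
    rw [hrepr _ hs]
    have hI : ‖∫ u, (Tprod T u x - x) ∂μ‖ ≤
        ∫ u, (-C) * (Real.exp (∑ j, (-‖y j‖ / n - ε) * u j) - 1) ∂μ := by
      refine norm_integral_le_of_norm_le (hi.const_mul _) ?_
      have hae : ∀ᵐ u ∂μ, (∀ j, 0 ≤ u j) ∧ u ≠ 0 := ae_iff.2 hμ
      filter_upwards [hae] with u hu
      refine (hbound u hu.1).trans ?_
      have : Real.exp (∑ j, (-‖y j‖ / n - ε) * u j) ≤ Real.exp (∑ j, -‖y j‖ / n * u j) := by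
        apply Real.exp_le_exp.2
        refine Finset.sum_le_sum fun j _ => ?_
        exact mul_le_mul_of_nonneg_right (by linarith) (hu.1 j)
      nlinarith
    rw [integral_const_mul] at hI
    have h0 : ‖c₀ • x‖ ≤ -(C * c₀) := by
      rw [norm_smul, hx, Real.norm_eq_abs, abs_of_nonpos hc0]
      nlinarith
    have h1 : ‖∑ j, c₁ j • y j‖ ≤ -(C * ∑ j, c₁ j * (-‖y j‖ / n - ε)) := by
      rw [Finset.mul_sum, ← Finset.sum_neg_distrib]
      refine norm_sum_le_of_le _ fun j _ => ?_
      rw [norm_smul, Real.norm_eq_abs, abs_of_nonneg (hc1 j)]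
      have e : -(C * (c₁ j * (-‖y j‖ / n - ε))) = c₁ j * (C * (‖y j‖ / n) + C * ε) := by ring
      rw [e]
      apply mul_le_mul_of_nonneg_left _ (hc1 j)
      have : ‖y j‖ = n * (‖y j‖ / n) := by field_simp
      have h2 : (n : ℝ) * (‖y j‖ / n) ≤ C * (‖y j‖ / n) :=
        mul_le_mul_of_nonneg_right hCn (by positivity)
      have h3 : 0 ≤ C * ε := by positivity
      linarith
    refine (norm_add₃_le).trans ?_
    rw [mul_add, mul_add]
    linarith
  have hmem : (fun j => -‖y j‖ / (n : ℝ)) ∈ nonposOrthant n := by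
    intro j
    have : 0 ≤ ‖y j‖ / n := by positivity
    simp only [neg_div]
    linarith
  have hlim : Tendsto (fun ε : ℝ => (fun j => -‖y j‖ / (n : ℝ) - ε : Fin n → ℝ)) (𝓝[>] 0)
      (𝓝[nonposOrthant n] (fun j => -‖y j‖ / (n : ℝ))) := by
    refine tendsto_nhdsWithin_iff.2 ⟨?_, ?_⟩
    · have hc : Continuous (fun ε : ℝ => (fun j => -‖y j‖ / (n : ℝ) - ε : Fin n → ℝ)) := by
        fun_prop
      have := hc.tendsto 0
      simp only [sub_zero] at this
      exact this.mono_left nhdsWithin_le_nhds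
    · filter_upwards [self_mem_nhdsWithin] with ε hε j
      have h1 : -‖y j‖ / (n : ℝ) ≤ 0 := hmem j
      have h2 : 0 < ε := hε
      show -‖y j‖ / (n : ℝ) - ε ≤ 0
      linarith
  have hfin := (((hcont _ hmem).tendsto.comp hlim).const_mul C).neg
  refine ge_of_tendsto hfin ?_
  filter_upwards [self_mem_nhdsWithin] with ε hε
  exact key ε hε
end

section
/- Let X = C₀(ℝⁿ) (continuous functions vanishing at infinity with the sup-norm), let T(u) be the semigroup of translations (T(u)x)(s) = x(s+u), u ∈ ℝ₊ⁿ, with partial generators A = (∂₁,…,∂ₙ) (partial differentiation operators). If ψ ∈ T_n is such that the operator ψ(A) is bounded on X, then the function ψ is bounded on (−∞,0)ⁿ. -/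
open MeasureTheory Filter Topology

lemma bb_xexp (a r : ℝ) : a * r ^ 2 * Real.exp (-(a * r ^ 2)) ≤ 1 :=
  (Real.mul_exp_neg_le_exp_neg_one _).trans (Real.exp_le_one_iff.2 (by norm_num))

lemma bb_exp_le_one {a : ℝ} (ha : 0 < a) (r : ℝ) : Real.exp (-(a * r ^ 2)) ≤ 1 :=
  Real.exp_le_one_iff.2 (by have := mul_nonneg ha.le (sq_nonneg r); linarith)

lemma bb_d1 {a : ℝ} (ha : 0 < a) (r : ℝ) :
    2 * a * |r| * Real.exp (-(a * r ^ 2)) ≤ 2 * a + 2 := by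
  have h1 := bb_xexp a r
  have h2 := bb_exp_le_one ha r
  have h3 := Real.exp_pos (-(a * r ^ 2))
  have h4 : |r| ≤ 1 + r ^ 2 := by
    rw [← sq_abs r]; nlinarith [sq_nonneg (|r| - 1), abs_nonneg r]
  have h5 : 2 * a * |r| * Real.exp (-(a * r ^ 2)) ≤
      2 * a * (1 + r ^ 2) * Real.exp (-(a * r ^ 2)) := by gcongr
  nlinarith

lemma bb_d2 {a : ℝ} (ha : 0 < a) (r : ℝ) :
    ‖(4 * a ^ 2 * r ^ 2 - 2 * a) * Real.exp (-(a * r ^ 2))‖ ≤ 4 * a := by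
  have h1 := bb_xexp a r
  have h2 := bb_exp_le_one ha r
  have h3 := Real.exp_pos (-(a * r ^ 2))
  have h4 : 0 ≤ a * r ^ 2 * Real.exp (-(a * r ^ 2)) := by positivity
  rw [Real.norm_eq_abs, abs_le]
  constructor <;> nlinarith

lemma bb_hd1 (a r : ℝ) : HasDerivAt (fun r : ℝ => Real.exp (-(a * r ^ 2)))
    (-(2 * a * r) * Real.exp (-(a * r ^ 2))) r := by
  have := (((hasDerivAt_id r).pow 2).const_mul a).neg.exp
  refine this.congr_deriv ?_
  simp; ring

lemma bb_hd2 (a r : ℝ) : HasDerivAt (fun r : ℝ => -(2 * a * r) * Real.exp (-(a * r ^ 2)))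
    ((4 * a ^ 2 * r ^ 2 - 2 * a) * Real.exp (-(a * r ^ 2))) r := by
  have := ((hasDerivAt_id r).const_mul (2 * a)).neg.mul (bb_hd1 a r)
  refine this.congr_deriv ?_
  simp; ring

lemma bb_taylor {a : ℝ} (ha : 0 < a) (r t : ℝ) (ht : 0 ≤ t) :
    |Real.exp (-(a * (r + t) ^ 2)) - Real.exp (-(a * r ^ 2))
      - t * (-(2 * a * r) * Real.exp (-(a * r ^ 2)))| ≤ 4 * a * t * t := by
  have hlip : ∀ x y : ℝ, ‖-(2 * a * y) * Real.exp (-(a * y ^ 2)) -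
      -(2 * a * x) * Real.exp (-(a * x ^ 2))‖ ≤ 4 * a * ‖y - x‖ := fun x y =>
    Convex.norm_image_sub_le_of_norm_hasDerivWithin_le (s := Set.univ)
      (f := fun r : ℝ => -(2 * a * r) * Real.exp (-(a * r ^ 2)))
      (fun z _ => (bb_hd2 a z).hasDerivWithinAt) (fun z _ => bb_d2 ha z)
      convex_univ (Set.mem_univ _) (Set.mem_univ _)
  have := Convex.norm_image_sub_le_of_norm_hasDerivWithin_le (s := Set.Icc r (r + t))
      (f := fun z : ℝ => Real.exp (-(a * z ^ 2)) - z * (-(2 * a * r) * Real.exp (-(a * r ^ 2))))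
      (f' := fun z => -(2 * a * z) * Real.exp (-(a * z ^ 2)) -
        1 * (-(2 * a * r) * Real.exp (-(a * r ^ 2))))
      (C := 4 * a * t) (x := r) (y := r + t)
      (fun z _ => ((bb_hd1 a z).sub ((hasDerivAt_id z).mul_const _)).hasDerivWithinAt)
      (fun z hz => by
        rw [one_mul]
        refine (hlip r z).trans ?_
        have h1 : 0 ≤ z - r := by linarith [hz.1]
        rw [Real.norm_of_nonneg h1]
        have : z - r ≤ t := by linarith [hz.2]
        gcongr)
      (convex_Icc _ _) ⟨le_rfl, by linarith⟩ ⟨by linarith, le_rfl⟩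
  rw [add_sub_cancel_left, Real.norm_eq_abs, Real.norm_of_nonneg ht] at this
  convert this using 2
  ring

/-- the real Gaussian -/
noncomputable def bbG {n : ℕ} (a : ℝ) (s : Fin n → ℝ) : ℝ := Real.exp (-(a * ∑ j, s j ^ 2))

lemma bbG_pos {n : ℕ} (a : ℝ) (s : Fin n → ℝ) : 0 < bbG a s := Real.exp_pos _

lemma bbG_le_coord {n : ℕ} {a : ℝ} (ha : 0 < a) (s : Fin n → ℝ) (j : Fin n) :
    bbG a s ≤ Real.exp (-(a * s j ^ 2)) := by
  unfold bbG
  have : s j ^ 2 ≤ ∑ j, s j ^ 2 :=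
    Finset.single_le_sum (f := fun j => s j ^ 2) (fun i _ => sq_nonneg _) (Finset.mem_univ j)
  gcongr

lemma bbG_le_one {n : ℕ} {a : ℝ} (ha : 0 < a) (s : Fin n → ℝ) : bbG a s ≤ 1 := by
  unfold bbG
  rw [Real.exp_le_one_iff]
  have : 0 ≤ ∑ j, s j ^ 2 := Finset.sum_nonneg fun i _ => sq_nonneg _
  have := mul_nonneg ha.le this
  linarith

lemma bbG_d1 {n : ℕ} {a : ℝ} (ha : 0 < a) (s : Fin n → ℝ) (j : Fin n) :
    2 * a * |s j| * bbG a s ≤ 2 * a + 2 := by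
  refine le_trans ?_ (bb_d1 ha (s j))
  have := bbG_le_coord ha s j
  gcongr

lemma bbG_lip {n : ℕ} {a : ℝ} (ha : 0 < a) (s u : Fin n → ℝ) :
    |bbG a (s + u) - bbG a s| ≤ (2 * a + 2) * ∑ j, |u j| := by
  have hd : ∀ τ : ℝ, HasDerivAt (fun τ : ℝ => bbG a (s + τ • u))
      (bbG a (s + τ • u) * -(a * ∑ j, 2 * (s j + τ * u j) * u j)) τ := by
    intro τ
    unfold bbG
    have h : ∀ j ∈ Finset.univ, HasDerivAt (fun τ : ℝ => (s j + τ * u j) ^ 2)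
        (2 * (s j + τ * u j) * u j) τ := by
      intro j _
      have := (((hasDerivAt_id τ).mul_const (u j)).const_add (s j)).pow 2
      refine this.congr_deriv ?_
      simp
    have := ((HasDerivAt.fun_sum h).const_mul a).neg.exp
    simpa using this
  have := Convex.norm_image_sub_le_of_norm_hasDerivWithin_le (s := Set.univ)
    (C := (2 * a + 2) * ∑ j, |u j|) (x := 0) (y := 1)
    (fun τ _ => (hd τ).hasDerivWithinAt) (fun τ _ => by
      rw [Real.norm_eq_abs, abs_mul, abs_neg, abs_mul, abs_of_pos (bbG_pos _ _), abs_of_pos ha]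
      calc bbG a (s + τ • u) * (a * |∑ j, 2 * (s j + τ * u j) * u j|)
          ≤ bbG a (s + τ • u) * (a * ∑ j, |2 * (s j + τ * u j) * u j|) := by
            have := (bbG_pos a (s + τ • u)).le
            gcongr
            exact Finset.abs_sum_le_sum_abs _ _
        _ = ∑ j, (2 * a * |(s + τ • u) j| * bbG a (s + τ • u)) * |u j| := by
            rw [Finset.mul_sum, Finset.mul_sum]
            refine Finset.sum_congr rfl fun j _ => ?_
            simp only [abs_mul, Pi.add_apply, Pi.smul_apply, smul_eq_mul, abs_two]
            ring
        _ ≤ ∑ j, (2 * a + 2) * |u j| := by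
            gcongr with j
            exact bbG_d1 ha _ j
        _ = _ := by rw [Finset.mul_sum])
    convex_univ (Set.mem_univ _) (Set.mem_univ _)
  simpa using this

lemma bbG_taylor {n : ℕ} {a : ℝ} (ha : 0 < a) (s : Fin n → ℝ) (j : Fin n) (t : ℝ) (ht : 0 ≤ t) :
    |bbG a (s + Pi.single j t) - bbG a s - t * (-(2 * a * s j) * bbG a s)| ≤ 4 * a * t * t := by
  have hsum : ∑ i, (s + Pi.single j t : Fin n → ℝ) i ^ 2 = (s j + t) ^ 2 + ∑ i ∈ Finset.univ.erase j, s i ^ 2 := by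
    rw [← Finset.add_sum_erase _ _ (Finset.mem_univ j)]
    congr 1
    · simp
    · refine Finset.sum_congr rfl fun i hi => ?_
      simp [Pi.single_eq_of_ne (Finset.ne_of_mem_erase hi)]
  have hsum0 : ∑ i, s i ^ 2 = (s j) ^ 2 + ∑ i ∈ Finset.univ.erase j, s i ^ 2 := by
    rw [← Finset.add_sum_erase _ _ (Finset.mem_univ j)]
  set R := ∑ i ∈ Finset.univ.erase j, s i ^ 2 with hR
  have hR0 : 0 ≤ R := Finset.sum_nonneg fun i _ => sq_nonneg _
  have e1 : bbG a (s + Pi.single j t) = Real.exp (-(a * (s j + t) ^ 2)) * Real.exp (-(a * R)) := by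
    rw [bbG, hsum, ← Real.exp_add]; ring_nf
  have e2 : bbG a s = Real.exp (-(a * s j ^ 2)) * Real.exp (-(a * R)) := by
    rw [bbG, hsum0, ← Real.exp_add]; ring_nf
  have hle : Real.exp (-(a * R)) ≤ 1 :=
    Real.exp_le_one_iff.2 (by have := mul_nonneg ha.le hR0; linarith)
  rw [e1, e2]
  have := bb_taylor ha (s j) t ht
  calc _ = |Real.exp (-(a * (s j + t) ^ 2)) - Real.exp (-(a * s j ^ 2))
      - t * (-(2 * a * s j) * Real.exp (-(a * s j ^ 2)))| * Real.exp (-(a * R)) := by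
        rw [← abs_of_pos (Real.exp_pos (-(a * R))), ← abs_mul, abs_of_pos (Real.exp_pos (-(a * R)))]
        congr 1; ring
    _ ≤ (4 * a * t * t) * 1 := by gcongr
    _ = _ := mul_one _

lemma bbG_cont {n : ℕ} (a : ℝ) : Continuous (fun s : Fin n → ℝ => bbG a s) := by
  unfold bbG; fun_prop

lemma bb_sum_ge {n : ℕ} (s : Fin n → ℝ) : ‖s‖ ^ 2 ≤ ∑ j, s j ^ 2 := by
  have h0 : 0 ≤ ∑ j, s j ^ 2 := Finset.sum_nonneg fun i _ => sq_nonneg _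
  rw [← Real.sqrt_le_sqrt_iff h0, Real.sqrt_sq (norm_nonneg _),
    pi_norm_le_iff_of_nonneg (Real.sqrt_nonneg _)]
  intro i
  rw [Real.norm_eq_abs, ← Real.sqrt_sq_eq_abs]
  exact Real.sqrt_le_sqrt
    (Finset.single_le_sum (f := fun j => s j ^ 2) (fun i _ => sq_nonneg _) (Finset.mem_univ i))

lemma bb_tend {n : ℕ} {a : ℝ} (ha : 0 < a) :
    Tendsto (fun s : Fin n → ℝ => (1 + ‖s‖) * bbG a s) (cocompact _) (𝓝 0) := by
  have h : Tendsto (fun r : ℝ => (1 + r) * Real.exp (-a * r)) atTop (𝓝 0) := by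
    have h1 := tendsto_rpow_mul_exp_neg_mul_atTop_nhds_zero 0 a ha
    have h2 := tendsto_rpow_mul_exp_neg_mul_atTop_nhds_zero 1 a ha
    have := h1.add h2
    simp only [Real.rpow_zero, Real.rpow_one, add_zero] at this
    refine this.congr fun r => by ring
  have h' := (h.comp (tendsto_norm_cocompact_atTop (E := Fin n → ℝ)))
  refine squeeze_zero' (Eventually.of_forall fun s => ?_) ?_ h'
  · have := bbG_pos a s; positivity
  · filter_upwards [(tendsto_norm_cocompact_atTop (E := Fin n → ℝ)).eventually_ge_atTop 1] with s hs
    have h3 := bb_sum_ge s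
    have : ‖s‖ ≤ ∑ j, s j ^ 2 := le_trans (by nlinarith) h3
    simp only [Function.comp, bbG]
    gcongr
    nlinarith

lemma bb_norm_le {n : ℕ} (f : ZeroAtInftyContinuousMap (Fin n → ℝ) ℂ) (C : ℝ)
    (hC : 0 ≤ C) (h : ∀ s, ‖f s‖ ≤ C) : ‖f‖ ≤ C := by
  rw [← ZeroAtInftyContinuousMap.norm_toBCF_eq_norm, BoundedContinuousFunction.norm_le hC]
  exact h

lemma bb_le_norm {n : ℕ} (f : ZeroAtInftyContinuousMap (Fin n → ℝ) ℂ) (s : Fin n → ℝ) :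
    ‖f s‖ ≤ ‖f‖ := by
  rw [← ZeroAtInftyContinuousMap.norm_toBCF_eq_norm]
  exact BoundedContinuousFunction.norm_coe_le_norm f.toBCF s

/-- evaluation at a point -/
noncomputable def bbEval {n : ℕ} (s : Fin n → ℝ) :
    ZeroAtInftyContinuousMap (Fin n → ℝ) ℂ →L[ℂ] ℂ :=
  LinearMap.mkContinuous
    { toFun := fun f => f s
      map_add' := fun _ _ => rfl
      map_smul' := fun _ _ => rfl } 1 (fun f => by simpa using bb_le_norm f s)

lemma bbEval_apply {n : ℕ} (s : Fin n → ℝ) (f : ZeroAtInftyContinuousMap (Fin n → ℝ) ℂ) :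
    bbEval s f = f s := rfl

/-- the Gaussian as an element of `C₀` -/
noncomputable def bbX {n : ℕ} (a : ℝ) (ha : 0 < a) :
    ZeroAtInftyContinuousMap (Fin n → ℝ) ℂ where
  toFun s := ((bbG a s : ℝ) : ℂ)
  continuous_toFun := Complex.continuous_ofReal.comp (bbG_cont a)
  zero_at_infty' := by
    refine squeeze_zero_norm (fun s => ?_) (bb_tend ha)
    rw [Complex.norm_real, Real.norm_of_nonneg (bbG_pos a s).le]
    have := bbG_pos a s
    have := norm_nonneg s
    nlinarith

/-- partial derivative of the Gaussian -/
noncomputable def bbY {n : ℕ} (a : ℝ) (ha : 0 < a) (j : Fin n) :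
    ZeroAtInftyContinuousMap (Fin n → ℝ) ℂ where
  toFun s := ((-(2 * a * s j) * bbG a s : ℝ) : ℂ)
  continuous_toFun := Complex.continuous_ofReal.comp
    (Continuous.mul (by fun_prop) (bbG_cont a))
  zero_at_infty' := by
    refine squeeze_zero_norm (a := fun s => (2 * a) * ((1 + ‖s‖) * bbG a s)) (fun s => ?_) ?_
    · rw [Complex.norm_real, norm_mul, Real.norm_of_nonneg (bbG_pos a s).le, norm_neg, norm_mul,
        Real.norm_of_nonneg (by positivity : 0 ≤ 2 * a), ← mul_assoc]
      have := bbG_pos a s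
      have := norm_le_pi_norm s j
      gcongr
      linarith
    · simpa using (bb_tend ha).const_mul (2 * a)

lemma bbX_apply {n : ℕ} (a : ℝ) (ha : 0 < a) (s : Fin n → ℝ) :
    bbX a ha s = ((bbG a s : ℝ) : ℂ) := rfl

lemma bbY_apply {n : ℕ} (a : ℝ) (ha : 0 < a) (j : Fin n) (s : Fin n → ℝ) :
    bbY a ha j s = ((-(2 * a * s j) * bbG a s : ℝ) : ℂ) := rfl

lemma bb_gen {n : ℕ} (T : (Fin n → ℝ) →
      (ZeroAtInftyContinuousMap (Fin n → ℝ) ℂ →L[ℂ] ZeroAtInftyContinuousMap (Fin n → ℝ) ℂ))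
    (hT : ∀ u, (∀ j, 0 ≤ u j) →
      ∀ (x : ZeroAtInftyContinuousMap (Fin n → ℝ) ℂ) (s : Fin n → ℝ), T u x s = x (s + u))
    (a : ℝ) (ha : 0 < a) (j : Fin n) :
    InGenDomain (fun t => T (Pi.single j t)) (bbX a ha) (bbY a ha j) := by
  unfold InGenDomain
  rw [tendsto_iff_norm_sub_tendsto_zero]
  have h0 : Tendsto (fun t : ℝ => 4 * a * t) (𝓝[>] 0) (𝓝 0) := by
    have : Continuous (fun t : ℝ => 4 * a * t) := by fun_prop
    simpa using (this.tendsto 0).mono_left nhdsWithin_le_nhds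
  refine squeeze_zero' (Eventually.of_forall fun _ => norm_nonneg _) ?_ h0
  filter_upwards [self_mem_nhdsWithin] with t ht
  have ht : 0 < t := ht
  refine bb_norm_le _ _ (by positivity) fun s => ?_
  have hp : ∀ i, 0 ≤ (Pi.single j t : Fin n → ℝ) i := by
    intro i
    by_cases h : i = j
    · subst h; simpa using ht.le
    · simp [h]
  rw [RCLike.real_smul_eq_coe_smul (K := ℂ), ZeroAtInftyContinuousMap.sub_apply,
    ZeroAtInftyContinuousMap.smul_apply, ZeroAtInftyContinuousMap.sub_apply, hT _ hp]
  have e : ((t⁻¹ : ℝ) : ℂ) • (bbX a ha (s + Pi.single j t) - bbX a ha s) - bbY a ha j s =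
      ((t⁻¹ * (bbG a (s + Pi.single j t) - bbG a s - t * (-(2 * a * s j) * bbG a s)) : ℝ) : ℂ) := by
    rw [bbX_apply, bbX_apply, bbY_apply, smul_eq_mul]
    have : (t : ℂ) ≠ 0 := by exact_mod_cast ht.ne'
    push_cast
    field_simp
  refine (congrArg norm e).trans_le ?_
  rw [Complex.norm_real, norm_mul, Real.norm_of_nonneg (by positivity : 0 ≤ t⁻¹), Real.norm_eq_abs]
  have := bbG_taylor ha s j t ht.le
  calc _ ≤ t⁻¹ * (4 * a * t * t) := by gcongr
    _ = _ := by field_simp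

lemma bb_Tlip {n : ℕ} (T : (Fin n → ℝ) →
      (ZeroAtInftyContinuousMap (Fin n → ℝ) ℂ →L[ℂ] ZeroAtInftyContinuousMap (Fin n → ℝ) ℂ))
    (hT : ∀ u, (∀ j, 0 ≤ u j) →
      ∀ (x : ZeroAtInftyContinuousMap (Fin n → ℝ) ℂ) (s : Fin n → ℝ), T u x s = x (s + u))
    (a : ℝ) (ha : 0 < a) (u v : Fin n → ℝ) (hu : ∀ j, 0 ≤ u j) (hv : ∀ j, 0 ≤ v j) :
    ‖T u (bbX a ha) - T v (bbX a ha)‖ ≤ (2 * a + 2) * ∑ j, |u j - v j| := by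
  refine bb_norm_le _ _ (by positivity) fun s => ?_
  rw [ZeroAtInftyContinuousMap.sub_apply, hT _ hu, hT _ hv]
  change ‖((bbG a (s + u) : ℝ) : ℂ) - ((bbG a (s + v) : ℝ) : ℂ)‖ ≤ _
  rw [← Complex.ofReal_sub, Complex.norm_real, Real.norm_eq_abs]
  have := bbG_lip ha (s + v) (u - v)
  have e : s + v + (u - v) = s + u := by abel
  rw [e] at this
  exact this

lemma bb_T0 {n : ℕ} (T : (Fin n → ℝ) →
      (ZeroAtInftyContinuousMap (Fin n → ℝ) ℂ →L[ℂ] ZeroAtInftyContinuousMap (Fin n → ℝ) ℂ))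
    (hT : ∀ u, (∀ j, 0 ≤ u j) →
      ∀ (x : ZeroAtInftyContinuousMap (Fin n → ℝ) ℂ) (s : Fin n → ℝ), T u x s = x (s + u))
    (x : ZeroAtInftyContinuousMap (Fin n → ℝ) ℂ) : T 0 x = x := by
  ext s; rw [hT 0 (by simp)]; simp

lemma bb_integrable {n : ℕ} {μ : Measure (Fin n → ℝ)}
    (hμ : ∀ᵐ u ∂μ, (∀ j, 0 ≤ u j) ∧ u ≠ 0)
    (hint : Integrable (fun u : Fin n → ℝ => Real.exp (∑ j, (-1 : ℝ) * u j) - 1) μ)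
    (T : (Fin n → ℝ) →
      (ZeroAtInftyContinuousMap (Fin n → ℝ) ℂ →L[ℂ] ZeroAtInftyContinuousMap (Fin n → ℝ) ℂ))
    (hT : ∀ u, (∀ j, 0 ≤ u j) →
      ∀ (x : ZeroAtInftyContinuousMap (Fin n → ℝ) ℂ) (s : Fin n → ℝ), T u x s = x (s + u))
    (a : ℝ) (ha : 0 < a) :
    Integrable (fun u => T u (bbX a ha) - bbX a ha) μ := by
  have hmeasS : MeasurableSet {u : Fin n → ℝ | ∀ j, 0 ≤ u j} := by
    have : {u : Fin n → ℝ | ∀ j, 0 ≤ u j} = Set.Ici 0 := by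
      ext u; simp [Pi.le_def]
    rw [this]; exact measurableSet_Ici
  have hres : μ.restrict {u : Fin n → ℝ | ∀ j, 0 ≤ u j} = μ :=
    Measure.restrict_eq_self_of_ae_mem (hμ.mono fun u h => h.1)
  have hco : ContinuousOn (fun u => T u (bbX a ha) - bbX a ha) {u : Fin n → ℝ | ∀ j, 0 ≤ u j} := by
    refine ContinuousOn.sub ?_ continuousOn_const
    intro v hv
    unfold ContinuousWithinAt
    rw [tendsto_iff_norm_sub_tendsto_zero]
    have h0 : Tendsto (fun u : Fin n → ℝ => (2 * a + 2) * ∑ j, |u j - v j|)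
        (𝓝[{u : Fin n → ℝ | ∀ j, 0 ≤ u j}] v) (𝓝 0) := by
      have : Continuous (fun u : Fin n → ℝ => (2 * a + 2) * ∑ j, |u j - v j|) := by fun_prop
      simpa using (this.tendsto v).mono_left nhdsWithin_le_nhds
    refine squeeze_zero' (Eventually.of_forall fun _ => norm_nonneg _) ?_ h0
    filter_upwards [self_mem_nhdsWithin] with u hu
    exact bb_Tlip T hT a ha u v hu hv
  have haesm := hco.aestronglyMeasurable (μ := μ) hmeasS
  rw [hres] at haesm
  refine (hint.const_mul (2 * a + 4)).mono haesm ?_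
  filter_upwards [hμ] with u hu
  set v := ∑ j, u j with hv
  have hv0 : 0 ≤ v := Finset.sum_nonneg fun j _ => hu.1 j
  have h1 : ‖T u (bbX a ha) - bbX a ha‖ ≤ (2 * a + 2) * v := by
    have := bb_Tlip T hT a ha u 0 hu.1 (by simp)
    rw [bb_T0 T hT] at this
    refine this.trans_eq ?_
    congr 1
    refine Finset.sum_congr rfl fun j _ => ?_
    simp [abs_of_nonneg (hu.1 j)]
  have h2 : ‖T u (bbX a ha) - bbX a ha‖ ≤ 2 := by
    refine bb_norm_le _ _ (by norm_num) fun s => ?_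
    rw [ZeroAtInftyContinuousMap.sub_apply, hT _ hu.1]
    change ‖((bbG a (s + u) : ℝ) : ℂ) - ((bbG a s : ℝ) : ℂ)‖ ≤ _
    rw [← Complex.ofReal_sub, Complex.norm_real, Real.norm_eq_abs, abs_le]
    have := bbG_le_one ha s
    have := bbG_pos a s
    have := bbG_le_one ha (s + u)
    have := bbG_pos a (s + u)
    constructor <;> linarith
  have e : ∑ j, (-1 : ℝ) * u j = -v := by simp [hv]
  rw [e, norm_mul, Real.norm_of_nonneg (by positivity : 0 ≤ 2 * a + 4), Real.norm_eq_abs, abs_sub_comm]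
  have h3 : Real.exp (-v) * (1 + v) ≤ 1 := by
    rw [Real.exp_neg, inv_mul_le_iff₀ (Real.exp_pos v), mul_one]
    linarith [Real.add_one_le_exp v]
  have h5 : v ≤ (1 - Real.exp (-v)) * (1 + v) := by linarith
  have h4 : ‖T u (bbX a ha) - bbX a ha‖ * (1 + v) ≤
      (2 * a + 4) * (1 - Real.exp (-v)) * (1 + v) := by
    calc _ ≤ (2 * a + 4) * v := by nlinarith
      _ ≤ (2 * a + 4) * ((1 - Real.exp (-v)) * (1 + v)) := by gcongr
      _ = _ := by ring
  refine (le_of_mul_le_mul_right h4 (by positivity)).trans ?_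
  gcongr
  exact le_abs_self _

/-- Pointwise consequence of boundedness. -/
lemma bb_key {n : ℕ} (c₀ : ℝ) (c₁ : Fin n → ℝ) {μ : Measure (Fin n → ℝ)}
    (hμ : ∀ᵐ u ∂μ, (∀ j, 0 ≤ u j) ∧ u ≠ 0)
    (hint : Integrable (fun u : Fin n → ℝ => Real.exp (∑ j, (-1 : ℝ) * u j) - 1) μ)
    (T : (Fin n → ℝ) →
      (ZeroAtInftyContinuousMap (Fin n → ℝ) ℂ →L[ℂ] ZeroAtInftyContinuousMap (Fin n → ℝ) ℂ))
    (hT : ∀ u, (∀ j, 0 ≤ u j) →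
      ∀ (x : ZeroAtInftyContinuousMap (Fin n → ℝ) ℂ) (s : Fin n → ℝ), T u x s = x (s + u))
    (C : ℝ) (hC : ∀ (x : ZeroAtInftyContinuousMap (Fin n → ℝ) ℂ)
        (y : Fin n → ZeroAtInftyContinuousMap (Fin n → ℝ) ℂ),
        (∀ j, InGenDomain (fun t => T (Pi.single j t)) x (y j)) →
        ‖c₀ • x + (∑ j, c₁ j • y j) + ∫ u, (T u x - x) ∂μ‖ ≤ C * ‖x‖)
    (a : ℝ) (ha : 0 < a) (s : Fin n → ℝ) :
    Integrable (fun u => bbG a (s + u) - bbG a s) μ ∧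
    |c₀ * bbG a s + (∑ j, c₁ j * (-(2 * a * s j) * bbG a s)) +
      ∫ u, (bbG a (s + u) - bbG a s) ∂μ| ≤ |C| := by
  have hI := bb_integrable hμ hint T hT a ha
  have hae : ∀ᵐ u ∂μ, bbEval s (T u (bbX a ha) - bbX a ha) =
      ((bbG a (s + u) - bbG a s : ℝ) : ℂ) := by
    filter_upwards [hμ] with u hu
    rw [bbEval_apply, ZeroAtInftyContinuousMap.sub_apply, hT _ hu.1, Complex.ofReal_sub, bbX_apply, bbX_apply]
  have hIc : Integrable (fun u => ((bbG a (s + u) - bbG a s : ℝ) : ℂ)) μ :=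
    ((bbEval s).integrable_comp hI).congr hae
  refine ⟨by simpa using hIc.re, ?_⟩
  have h1 := hC (bbX a ha) (bbY a ha) (bb_gen T hT a ha)
  have hn : ‖(bbX a ha : ZeroAtInftyContinuousMap (Fin n → ℝ) ℂ)‖ ≤ 1 := by
    refine bb_norm_le _ _ zero_le_one fun s => ?_
    change ‖((bbG a s : ℝ) : ℂ)‖ ≤ 1
    rw [Complex.norm_real, Real.norm_of_nonneg (bbG_pos a s).le]
    exact bbG_le_one ha s
  have h2 : C * ‖(bbX a ha : ZeroAtInftyContinuousMap (Fin n → ℝ) ℂ)‖ ≤ |C| := by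
    calc _ ≤ |C| * 1 := mul_le_mul (le_abs_self C) hn (norm_nonneg _) (abs_nonneg _)
      _ = _ := mul_one _
  have h3 := (bb_le_norm _ s).trans (h1.trans h2)
  rw [← Real.norm_eq_abs, ← Complex.norm_real]
  refine le_trans (le_of_eq (congrArg norm ?_)) h3
  have hint2 := (bbEval s).integral_comp_comm hI
  rw [integral_congr_ae hae, integral_complex_ofReal] at hint2
  rw [← bbEval_apply, map_add, map_add, map_sum, ← hint2]
  simp only [Complex.ofReal_add, Complex.ofReal_mul, Complex.ofReal_sum]
  congr 1
  congr 1
  · refine Finset.sum_congr rfl fun j _ => ?_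
    rw [bbEval_apply, ZeroAtInftyContinuousMap.smul_apply, Complex.real_smul, bbY_apply, Complex.ofReal_mul]

/-- Let `X = C₀(ℝⁿ)` (continuous functions vanishing at infinity, with
the sup-norm), let `T(u)` be the semigroup of translations `(T(u)x)(s) = x(s+u)` for
`u ∈ ℝ₊ⁿ`, with partial generators `A = (∂₁,…,∂ₙ)` (the generator of `t ↦ T(t eⱼ)`).
If `ψ ∈ 𝒯ₙ` is such that the operator `ψ(A)` is bounded, then `ψ` is bounded on
`(-∞,0)ⁿ`. -/
theorem bounded_bernstein_of_bounded_on_translations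
    {n : ℕ} (ψ : (Fin n → ℝ) → ℝ) (c₀ : ℝ) (c₁ : Fin n → ℝ)
    (μ : MeasureTheory.Measure (Fin n → ℝ))
    (hψ : MemTn n ψ) (hrep : HasLevyRep n ψ c₀ c₁ μ)
    (T : (Fin n → ℝ) →
      (ZeroAtInftyContinuousMap (Fin n → ℝ) ℂ →L[ℂ] ZeroAtInftyContinuousMap (Fin n → ℝ) ℂ))
    (hT : ∀ u, (∀ j, 0 ≤ u j) →
      ∀ (x : ZeroAtInftyContinuousMap (Fin n → ℝ) ℂ) (s : Fin n → ℝ), T u x s = x (s + u))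
    (hbdd : ∃ C : ℝ, ∀ (x : ZeroAtInftyContinuousMap (Fin n → ℝ) ℂ)
        (y : Fin n → ZeroAtInftyContinuousMap (Fin n → ℝ) ℂ),
        (∀ j, InGenDomain (fun t => T (Pi.single j t)) x (y j)) →
        ‖c₀ • x + (∑ j, c₁ j • y j) + ∫ u, (T u x - x) ∂μ‖ ≤ C * ‖x‖) :
    ∃ K : ℝ, ∀ s ∈ negOrthant n, |ψ s| ≤ K := by
  obtain ⟨C, hC⟩ := hbdd
  obtain ⟨hc0, hc1, hμ0, hint, hrep⟩ := hrep
  have hμ : ∀ᵐ u ∂μ, (∀ j, 0 ≤ u j) ∧ u ≠ 0 := hμ0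
  have hint1 : Integrable (fun u : Fin n → ℝ => Real.exp (∑ j, (-1 : ℝ) * u j) - 1) μ :=
    hint (fun _ => -1) (fun _ => by norm_num)
  have key := bb_key c₀ c₁ hμ hint1 T hT C hC
  -- the measure is finite
  have hfin : μ Set.univ ≤ ENNReal.ofReal (|C| + |c₀|) := by
    have hb : ∀ m : ℕ, ∫⁻ u, ENNReal.ofReal (1 - bbG ((m : ℝ) + 1) u) ∂μ ≤
        ENNReal.ofReal (|C| + |c₀|) := by
      intro m
      have ha : (0 : ℝ) < m + 1 := by positivity
      obtain ⟨hi, hle⟩ := key (m + 1) ha 0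
      have hG0 : bbG ((m : ℝ) + 1) (0 : Fin n → ℝ) = 1 := by simp [bbG]
      simp only [hG0, zero_add, Pi.zero_apply, mul_zero, neg_zero, zero_mul,
        Finset.sum_const_zero, add_zero, mul_one] at hi hle
      have hi' : Integrable (fun u => 1 - bbG ((m : ℝ) + 1) u) μ := by
        refine hi.neg.congr (Eventually.of_forall fun u => ?_)
        simp
      rw [← ofReal_integral_eq_lintegral_ofReal hi'
        (Eventually.of_forall fun u => sub_nonneg.2 (bbG_le_one ha u))]
      apply ENNReal.ofReal_le_ofReal
      have e : ∫ u, (1 - bbG ((m : ℝ) + 1) u) ∂μ = - ∫ u, (bbG ((m : ℝ) + 1) u - 1) ∂μ := by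
        rw [← integral_neg]; simp
      rw [e]
      have := (abs_le.1 hle).1
      linarith [le_abs_self c₀]
    have hlim : ∀ᵐ u ∂μ, liminf (fun m : ℕ => ENNReal.ofReal (1 - bbG ((m : ℝ) + 1) u)) atTop
        = 1 := by
      filter_upwards [hμ] with u hu
      apply Tendsto.liminf_eq
      have hpos : 0 < ∑ j, u j ^ 2 :=
        lt_of_lt_of_le (pow_pos (norm_pos_iff.2 hu.2) 2) (bb_sum_ge u)
      have h1 : Tendsto (fun m : ℕ => ((m : ℝ) + 1) * ∑ j, u j ^ 2) atTop atTop :=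
        (tendsto_atTop_add_const_right _ _ tendsto_natCast_atTop_atTop).atTop_mul_const hpos
      have h2 : Tendsto (fun m : ℕ => bbG ((m : ℝ) + 1) u) atTop (𝓝 0) :=
        Real.tendsto_exp_neg_atTop_nhds_zero.comp h1
      have h3 := ENNReal.tendsto_ofReal (h2.const_sub 1)
      simpa using h3
    calc μ Set.univ = ∫⁻ u, liminf (fun m : ℕ => ENNReal.ofReal (1 - bbG ((m : ℝ) + 1) u)) atTop ∂μ := by
          rw [lintegral_congr_ae hlim]; simp
      _ ≤ liminf (fun m : ℕ => ∫⁻ u, ENNReal.ofReal (1 - bbG ((m : ℝ) + 1) u) ∂μ) atTop :=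
          lintegral_liminf_le fun m =>
            (continuous_const.sub (bbG_cont _)).measurable.ennreal_ofReal
      _ ≤ ENNReal.ofReal (|C| + |c₀|) := by
          refine (liminf_le_liminf (Eventually.of_forall hb)).trans ?_
          simp
  haveI : IsFiniteMeasure μ := ⟨hfin.trans_lt ENNReal.ofReal_lt_top⟩
  have hintle : ∀ g : (Fin n → ℝ) → ℝ, (∀ᵐ u ∂μ, |g u| ≤ 1) →
      |∫ u, g u ∂μ| ≤ μ.real Set.univ := by
    intro g hg
    have := norm_integral_le_of_norm_le_const (μ := μ) (f := g) (C := 1) hg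
    simpa using this
  -- the drift vanishes
  have hc : ∀ j, c₁ j = 0 := by
    have hS0 : 0 ≤ ∑ j, c₁ j := Finset.sum_nonneg fun j _ => hc1 j
    have hS : ∑ j, c₁ j ≤ 0 := by
      by_contra hpos
      push Not at hpos
      set E := Real.exp (-(n : ℝ)) with hE
      have hEpos : 0 < E := Real.exp_pos _
      obtain ⟨m, hm⟩ := exists_nat_gt ((|C| + |c₀| + μ.real Set.univ) / (2 * E * ∑ j, c₁ j))
      rw [div_lt_iff₀ (by positivity)] at hm
      have hm0 : (0 : ℝ) < m := by
        by_contra h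
        have h0 : (m : ℝ) = 0 := le_antisymm (not_lt.1 h) (Nat.cast_nonneg m)
        rw [h0, zero_mul] at hm
        have : 0 ≤ |C| + |c₀| + μ.real Set.univ := by positivity
        linarith
      have ha : (0 : ℝ) < (m : ℝ) ^ 2 := by positivity
      obtain ⟨hi, hle⟩ := key ((m : ℝ) ^ 2) ha (fun _ => -(m : ℝ)⁻¹)
      have hG : bbG ((m : ℝ) ^ 2) (fun _ : Fin n => -(m : ℝ)⁻¹) = E := by
        rw [bbG, hE]
        congr 2
        simp only [Finset.sum_const, Finset.card_univ, Fintype.card_fin, nsmul_eq_mul]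
        field_simp
      have hI := hintle (fun u => bbG ((m : ℝ) ^ 2) ((fun _ => -(m : ℝ)⁻¹) + u) -
        bbG ((m : ℝ) ^ 2) (fun _ : Fin n => -(m : ℝ)⁻¹)) (Eventually.of_forall fun u => by
          have h1 := bbG_le_one ha (fun _ : Fin n => -(m : ℝ)⁻¹)
          have h2 := bbG_pos ((m : ℝ) ^ 2) (fun _ : Fin n => -(m : ℝ)⁻¹)
          have h3 := bbG_le_one ha ((fun _ : Fin n => -(m : ℝ)⁻¹) + u)
          have h4 := bbG_pos ((m : ℝ) ^ 2) ((fun _ : Fin n => -(m : ℝ)⁻¹) + u)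
          rw [abs_le]; constructor <;> linarith)
      rw [hG] at hle hI
      have hsum : ∑ j, c₁ j * (-(2 * (m : ℝ) ^ 2 * -(m : ℝ)⁻¹) * E) =
          m * (2 * E * ∑ j, c₁ j) := by
        rw [← Finset.sum_mul]
        field_simp
      rw [hsum] at hle
      have h1 := (abs_le.1 hle).2
      have h2 := (abs_le.1 hI).1
      have hE1 : E ≤ 1 := Real.exp_le_one_iff.2 (by simp)
      have h3 : -|c₀| ≤ c₀ * E := by
        have : |c₀ * E| ≤ |c₀| := by
          rw [abs_mul, abs_of_pos hEpos]
          exact mul_le_of_le_one_right (abs_nonneg _) hE1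
        linarith [(abs_le.1 this).1]
      linarith
    have := (Finset.sum_eq_zero_iff_of_nonneg (fun j _ => hc1 j)).1 (le_antisymm hS hS0)
    exact fun j => this j (Finset.mem_univ j)
  refine ⟨|c₀| + μ.real Set.univ, fun s hs => ?_⟩
  rw [hrep s hs]
  have hz : ∑ j, c₁ j * s j = 0 := Finset.sum_eq_zero fun j _ => by rw [hc j, zero_mul]
  rw [hz, add_zero]
  refine (abs_add_le _ _).trans ?_
  gcongr
  refine hintle _ ?_
  filter_upwards [hμ] with u hu
  have h1 : ∑ j, s j * u j ≤ 0 :=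
    Finset.sum_nonpos fun j _ => mul_nonpos_of_nonpos_of_nonneg (hs j).le (hu.1 j)
  have h2 := Real.exp_le_one_iff.2 h1
  have h3 := Real.exp_pos (∑ j, s j * u j)
  rw [abs_le]; constructor <;> linarith
end

section
/- Let A₁,…,Aₙ be pairwise commuting generators of C₀-semigroups on a complex Banach space X with ‖Tⱼ(t)‖ ≤ M for all j. If a sequence of functions ψ_k ∈ T_n converges to zero pointwise on (−∞,0]ⁿ, then ψ_k(A)x → 0 in X for every x ∈ D(A). -/
open MeasureTheory Filter Topology

theorem aux_gen {X : Type*} [NormedAddCommGroup X] [NormedSpace ℂ X]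
    (T : ℝ → X →L[ℂ] X) (M : ℝ) (hM : ∀ t, 0 ≤ t → ‖T t‖ ≤ M) (h0 : T 0 = 1)
    (x y : X) (h : InGenDomain T x y) :
    ∃ C : ℝ, 0 ≤ C ∧ ∀ t, 0 ≤ t → ‖T t x - x‖ ≤ C * (1 - Real.exp (-t)) := by
  have hM0 : 0 ≤ M := (norm_nonneg _).trans (hM 0 le_rfl)
  have h1 : ∀ᶠ t in 𝓝[>] (0 : ℝ), ‖t⁻¹ • (T t x - x)‖ < ‖y‖ + 1 :=
    h.norm.eventually (gt_mem_nhds (by linarith))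
  rw [eventually_nhdsWithin_iff, Metric.eventually_nhds_iff] at h1
  obtain ⟨d, hd, h1⟩ := h1
  set e := min (d / 2) 1 with he
  have he0 : 0 < e := lt_min (by linarith) one_pos
  have hed : e < d := (min_le_left _ _).trans_lt (by linarith)
  have he1 : e ≤ 1 := min_le_right _ _
  have hE : 0 < 1 - Real.exp (-e) := by
    have : Real.exp (-e) < 1 := Real.exp_lt_one_iff.2 (by linarith)
    linarith
  have hA : 0 ≤ 2 * (‖y‖ + 1) := by positivity
  have hB : 0 ≤ (M + 1) * ‖x‖ / (1 - Real.exp (-e)) := by positivity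
  refine ⟨2 * (‖y‖ + 1) + (M + 1) * ‖x‖ / (1 - Real.exp (-e)), by positivity, fun t ht => ?_⟩
  have hq : 0 ≤ 1 - Real.exp (-t) := by
    have : Real.exp (-t) ≤ 1 := Real.exp_le_one_iff.2 (by linarith)
    linarith
  rw [add_mul]
  rcases ht.eq_or_lt with rfl | ht0
  · simp [h0]
  by_cases hte : t ≤ e
  · have h2 := h1 (y := t) (by rw [Real.dist_eq, sub_zero, abs_of_pos ht0]; linarith) ht0
    rw [norm_smul, norm_inv, Real.norm_eq_abs, abs_of_pos ht0, inv_mul_lt_iff₀ ht0] at h2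
    have h3 : t ≤ 2 * (1 - Real.exp (-t)) := by
      have h4 := Real.add_one_le_exp t
      have h5 : Real.exp (-t) * Real.exp t = 1 := by rw [← Real.exp_add]; simp
      have h6 := Real.exp_pos (-t)
      nlinarith [mul_le_mul_of_nonneg_left h4 h6.le]
    have : t * (‖y‖ + 1) ≤ 2 * (1 - Real.exp (-t)) * (‖y‖ + 1) :=
      mul_le_mul_of_nonneg_right h3 (by positivity)
    have := mul_nonneg hB hq
    linarith
  · have h2 : ‖T t x - x‖ ≤ (M + 1) * ‖x‖ := by
      have := norm_sub_le (T t x) x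
      have := (T t).le_of_opNorm_le (hM t ht) x
      linarith
    have h3 : Real.exp (-t) ≤ Real.exp (-e) := Real.exp_le_exp.2 (by linarith)
    have h4 : (M + 1) * ‖x‖ / (1 - Real.exp (-e)) * (1 - Real.exp (-e)) ≤
        (M + 1) * ‖x‖ / (1 - Real.exp (-e)) * (1 - Real.exp (-t)) :=
      mul_le_mul_of_nonneg_left (by linarith) hB
    rw [div_mul_cancel₀ _ hE.ne'] at h4
    have := mul_nonneg hA hq
    linarith

theorem aux_list {X : Type*} [NormedAddCommGroup X] [NormedSpace ℂ X]
    (M b : ℝ) (hM : 1 ≤ M) (hb : 0 ≤ b) (x : X) (l : List (X →L[ℂ] X))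
    (h1 : ∀ S ∈ l, ‖S‖ ≤ M) (h2 : ∀ S ∈ l, ‖S x - x‖ ≤ b) :
    ‖l.prod x - x‖ ≤ l.length * M ^ l.length * b := by
  induction l with
  | nil => simp
  | cons S l ih =>
    have ih := ih (fun S hS => h1 S (by simp [hS])) (fun S hS => h2 S (by simp [hS]))
    have e : (S :: l).prod x - x = S (l.prod x - x) + (S x - x) := by simp
    rw [e]
    have a1 := norm_add_le (S (l.prod x - x)) (S x - x)
    have a2 := S.le_of_opNorm_le (h1 S (by simp)) (l.prod x - x)
    have a3 := h2 S (by simp)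
    have a4 := mul_le_mul_of_nonneg_left ih (zero_le_one.trans hM)
    have a5 : b ≤ M ^ (l.length + 1) * b := le_mul_of_one_le_left hb (one_le_pow₀ hM)
    simp only [List.length_cons, Nat.cast_add, Nat.cast_one]
    calc _ ≤ M * (l.length * M ^ l.length * b) + M ^ (l.length + 1) * b := by linarith
      _ = _ := by ring

/-- Let `A₁,…,Aₙ` be pairwise commuting generators of `C₀`-semigroups
with `‖Tⱼ(t)‖ ≤ M`. If a sequence of Bernstein functions `ψₖ ∈ 𝒯ₙ` converges to zero
pointwise on `(-∞,0]ⁿ`, then `ψₖ(A)x → 0` for every `x ∈ D(A)` (with `Aⱼ x = yⱼ`), where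
`ψₖ(A)x` is given by the representation formula. -/
theorem tendsto_zero_of_pointwise_tendsto_zero
    {X : Type*} [NormedAddCommGroup X] [NormedSpace ℂ X] [CompleteSpace X]
    {n : ℕ} (T : Fin n → ℝ → X →L[ℂ] X) (M : ℝ)
    (hT : ∀ j, IsC0Semigroup (T j)) (hM : ∀ j t, 0 ≤ t → ‖T j t‖ ≤ M)
    (hcomm : ∀ i j s t, 0 ≤ s → 0 ≤ t → T i s ∘L T j t = T j t ∘L T i s)
    (ψ : ℕ → (Fin n → ℝ) → ℝ) (c₀ : ℕ → ℝ) (c₁ : ℕ → Fin n → ℝ)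
    (μ : ℕ → MeasureTheory.Measure (Fin n → ℝ))
    (hψ : ∀ k, MemTn n (ψ k)) (hrep : ∀ k, HasLevyRep n (ψ k) (c₀ k) (c₁ k) (μ k))
    (hcont : ∀ k, ContinuousOn (ψ k) (nonposOrthant n))
    (hconv : ∀ s ∈ nonposOrthant n, Tendsto (fun k => ψ k s) atTop (𝓝 0))
    (x : X) (y : Fin n → X) (hy : ∀ j, InGenDomain (T j) x (y j)) :
    Tendsto (fun k => c₀ k • x + (∑ j, c₁ k j • y j) + ∫ u, (Tprod T u x - x) ∂(μ k))
      atTop (𝓝 0) := by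
  have hC : ∀ j, ∃ C : ℝ, 0 ≤ C ∧ ∀ t, 0 ≤ t → ‖T j t x - x‖ ≤ C * (1 - Real.exp (-t)) :=
    fun j => aux_gen (T j) M (hM j) (hT j).1 x (y j) (hy j)
  choose C hC0 hC using hC
  set D := ∑ j, C j with hD
  have hD0 : 0 ≤ D := Finset.sum_nonneg fun j _ => hC0 j
  set K : ℝ := n * (max M 1) ^ n * D with hK
  have hbound : ∀ u : Fin n → ℝ, (∀ j, 0 ≤ u j) →
      ‖Tprod T u x - x‖ ≤ K * (1 - Real.exp (∑ j, (-1) * u j)) := by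
    intro u hu
    have hs : 0 ≤ ∑ j, u j := Finset.sum_nonneg fun j _ => hu j
    have hsum : ∑ j, (-1) * u j = -∑ j, u j := by rw [← Finset.mul_sum]; ring
    have hq : 0 ≤ 1 - Real.exp (-∑ j, u j) := by
      have : Real.exp (-∑ j, u j) ≤ 1 := Real.exp_le_one_iff.2 (by linarith)
      linarith
    have := aux_list (max M 1) (D * (1 - Real.exp (-∑ j, u j))) (le_max_right _ _)
      (mul_nonneg hD0 hq) x (List.ofFn fun j => T j (u j))
      (by
        intro S hS
        obtain ⟨j, rfl⟩ := (List.mem_ofFn' _ _).1 hS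
        exact (hM j _ (hu j)).trans (le_max_left _ _))
      (by
        intro S hS
        obtain ⟨j, rfl⟩ := (List.mem_ofFn' _ _).1 hS
        refine (hC j _ (hu j)).trans ?_
        have h1 : C j ≤ D := Finset.single_le_sum (fun i _ => hC0 i) (Finset.mem_univ j)
        have h2 : u j ≤ ∑ i, u i := Finset.single_le_sum (fun i _ => hu i) (Finset.mem_univ j)
        have h3 : Real.exp (-∑ j, u j) ≤ Real.exp (-u j) := Real.exp_le_exp.2 (by linarith)
        calc C j * (1 - Real.exp (-u j)) ≤ C j * (1 - Real.exp (-∑ j, u j)) :=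
              mul_le_mul_of_nonneg_left (by linarith) (hC0 j)
          _ ≤ _ := mul_le_mul_of_nonneg_right h1 hq)
    rw [List.length_ofFn] at this
    rw [hsum, hK, mul_assoc _ D]
    exact this
  have hK0 : 0 ≤ K := by positivity
  set s0 : Fin n → ℝ := fun _ => -1 with hs0
  have hs0n : s0 ∈ negOrthant n := fun j => by simp [hs0]
  have hs0c : s0 ∈ nonposOrthant n := fun j => by simp [hs0]
  set L : ℝ := ‖x‖ + ∑ j, ‖y j‖ + K with hL
  have hYs : 0 ≤ ∑ j, ‖y j‖ := Finset.sum_nonneg fun j _ => norm_nonneg _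
  have key : ∀ k, ‖c₀ k • x + (∑ j, c₁ k j • y j) + ∫ u, (Tprod T u x - x) ∂(μ k)‖ ≤
      L * (-ψ k s0) := by
    intro k
    obtain ⟨hc0, hc1, hμ, hint, hrep⟩ := hrep k
    have hae : ∀ᵐ u ∂(μ k), (∀ j, 0 ≤ u j) ∧ u ≠ 0 := hμ
    have hi := hint s0 hs0n
    have hr := hrep s0 hs0n
    simp only [hs0] at hi hr
    set I := ∫ u, (Real.exp (∑ j, (-1) * u j) - 1) ∂(μ k) with hI
    have hI0 : I ≤ 0 := by
      apply integral_nonpos_of_ae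
      filter_upwards [hae] with u hu
      have : Real.exp (∑ j, (-1) * u j) ≤ 1 :=
        Real.exp_le_one_iff.2 (Finset.sum_nonpos fun j _ => by linarith [hu.1 j])
      simpa using this
    have b3 : ‖∫ u, (Tprod T u x - x) ∂(μ k)‖ ≤ K * (-I) := by
      have := norm_integral_le_of_norm_le (f := fun u => Tprod T u x - x)
        (g := fun u => (-K) * (Real.exp (∑ j, (-1) * u j) - 1)) (hi.const_mul (-K))
        (by
          filter_upwards [hae] with u hu
          have := hbound u hu.1
          linarith)
      rw [integral_const_mul] at this
      linarith
    have hS : ∑ j, c₁ k j * (-1 : ℝ) = -∑ j, c₁ k j := by rw [← Finset.sum_mul]; ring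
    have hS0 : 0 ≤ ∑ j, c₁ k j := Finset.sum_nonneg fun j _ => hc1 j
    rw [hS] at hr
    have hP : -ψ k s0 = -c₀ k + ∑ j, c₁ k j + (-I) := by
      simp only [hs0]; rw [hr]; ring
    have b1 : ‖c₀ k • x‖ ≤ ‖x‖ * (-ψ k s0) := by
      rw [norm_smul, Real.norm_eq_abs, abs_of_nonpos hc0, mul_comm]
      exact mul_le_mul_of_nonneg_left (by linarith) (norm_nonneg _)
    have b2 : ‖∑ j, c₁ k j • y j‖ ≤ (∑ j, ‖y j‖) * (-ψ k s0) := by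
      rw [Finset.sum_mul]
      refine norm_sum_le_of_le _ fun j _ => ?_
      rw [norm_smul, Real.norm_eq_abs, abs_of_nonneg (hc1 j), mul_comm]
      have := Finset.single_le_sum (fun i _ => hc1 i) (Finset.mem_univ j)
      exact mul_le_mul_of_nonneg_left (by linarith) (norm_nonneg _)
    have b4 : K * (-I) ≤ K * (-ψ k s0) := mul_le_mul_of_nonneg_left (by linarith) hK0
    have := norm_add₃_le (a := c₀ k • x) (b := ∑ j, c₁ k j • y j)
      (c := ∫ u, (Tprod T u x - x) ∂(μ k))
    rw [hL, add_mul, add_mul]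
    linarith
  refine squeeze_zero_norm key ?_
  simpa using ((hconv s0 hs0c).neg.const_mul L)
end
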